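/- arXiv:2601.15107 — 4 statements merged into one kernel-verified Lean document; each statement's English description precedes it below -/
import Mathlib

section
/- Assume (H3) and ∫₀¹ f(t) dt ≥ 0. Suppose there exists t_* ∈ [0, 1] with t_* ≠ s_* such that ∫_{s_*}^{t_*} (h(s_*) − h(t)) dt ≤ 0. Then there exists c* ∈ ℝ such that, for every c ∈ ℝ, the boundary value problem on [0, 1] admits a positive solution if and only if c = c*; the positive solution at c = c* is unique, and c* satisfies h_m − (p')^{1/p'} p^{1/p} μ̃^{1/p'} < c* < h_M + (p')^{1/p'} p^{1/p} μ̂^{1/p'}, both inequalities understood in the extended reals (being vacuous when μ̃ = ∞, respectively μ̂ = ∞). -/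
open MeasureTheory Set Filter Topology intervalIntegral

noncomputable section

/-- A Carathéodory solution on `[a,b]` of the ODE
`y'(t) = p' * ((c - h t) * (y⁺ t)^(1/p) - f t)`, in integral form. -/
def IsCaraSol (p p' : ℝ) (h f : ℝ → ℝ) (c a b : ℝ) (y : ℝ → ℝ) : Prop :=
  ContinuousOn y (Set.Icc a b) ∧
  ∀ t ∈ Set.Icc a b,
    y t = y a + ∫ u in a..t, p' * ((c - h u) * (max (y u) 0) ^ (1 / p) - f u)

/-- A positive solution of the boundary value problem on `[a,b]`. -/
def IsPosBVPSol (p p' : ℝ) (h f : ℝ → ℝ) (c a b : ℝ) (y : ℝ → ℝ) : Prop :=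
  IsCaraSol p p' h f c a b y ∧ y a = 0 ∧ y b = 0 ∧ ∀ t ∈ Set.Ioo a b, 0 < y t

/-- `u` is absolutely continuous on `[a, b]` and has derivative `u'` almost everywhere there. -/
def HasACDeriv (u u' : ℝ → ℝ) (a b : ℝ) : Prop :=
  AbsolutelyContinuousOnInterval u a b ∧ ∀ᵐ t : ℝ, t ∈ Ioo a b → HasDerivAt u (u' t) t

namespace HasACDeriv

variable {u u' v v' : ℝ → ℝ} {a b : ℝ}

lemma mono (hu : HasACDeriv u u' a b) {r t : ℝ} (har : a ≤ r) (hrt : r ≤ t) (htb : t ≤ b) :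
    HasACDeriv u u' r t := by
  refine ⟨hu.1.mono ?_, ?_⟩
  · rw [uIcc_of_le hrt, uIcc_of_le (by linarith)]
    exact Icc_subset_Icc har htb
  · filter_upwards [hu.2] with x hx hxm
    exact hx ⟨by linarith [hxm.1], by linarith [hxm.2]⟩

lemma sub (hu : HasACDeriv u u' a b) (hv : HasACDeriv v v' a b) :
    HasACDeriv (fun t => u t - v t) (fun t => u' t - v' t) a b := by
  refine ⟨hu.1.sub hv.1, ?_⟩
  filter_upwards [hu.2, hv.2] with x hx hx' hxm
  exact (hx hxm).sub (hx' hxm)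

lemma of_integral {y F : ℝ → ℝ} (hab : a ≤ b) (hF : IntervalIntegrable F volume a b)
    (hy : ∀ t ∈ Icc a b, y t = y a + ∫ τ in a..t, F τ) : HasACDeriv y F a b := by
  have hac := hF.absolutelyContinuousOnInterval_intervalIntegral (c := a) left_mem_uIcc
  constructor
  · rw [absolutelyContinuousOnInterval_iff] at hac ⊢
    intro ε hε
    obtain ⟨δ, hδ, H⟩ := hac ε hε
    refine ⟨δ, hδ, fun E hE hlt => ?_⟩
    convert H E hE hlt using 2 with i hi
    have h1 := hE.1 i hi
    rw [uIcc_of_le hab] at h1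
    rw [hy _ h1.1, hy _ h1.2, dist_add_left]
  · filter_upwards [hF.ae_hasDerivAt_integral] with x hx hxm
    have hxm' : x ∈ uIcc a b := by rw [uIcc_of_le hab]; exact Ioo_subset_Icc_self hxm
    have := (hx hxm' a left_mem_uIcc).const_add (y a)
    refine this.congr_of_eventuallyEq ?_
    filter_upwards [isOpen_Ioo.mem_nhds hxm] with t ht
    exact hy t (Ioo_subset_Icc_self ht)

lemma linear (k a b : ℝ) (hab : a ≤ b) : HasACDeriv (fun t => k * t) (fun _ => k) a b := by
  refine of_integral hab intervalIntegrable_const fun t _ => ?_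
  simp; ring

lemma comp {φ φ' : ℝ → ℝ} {m N C : ℝ} (hab : a ≤ b) (hu : HasACDeriv u u' a b)
    (hmem : ∀ t ∈ Icc a b, u t ∈ Icc m N)
    (hφ : ∀ x ∈ Icc m N, HasDerivAt φ (φ' x) x) (hC : ∀ x ∈ Icc m N, |φ' x| ≤ C) :
    HasACDeriv (fun t => φ (u t)) (fun t => φ' (u t) * u' t) a b := by
  constructor
  · have hlip : ∀ x ∈ Icc m N, ∀ z ∈ Icc m N, dist (φ x) (φ z) ≤ C * dist x z := by
      intro x hx z hz
      rw [dist_eq_norm, dist_eq_norm]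
      exact (convex_Icc m N).norm_image_sub_le_of_norm_hasDerivWithin_le
        (fun w hw => (hφ w hw).hasDerivWithinAt) hC hz hx
    have h1 := (Tendsto.const_mul C hu.1)
    rw [mul_zero] at h1
    refine squeeze_zero' (Eventually.of_forall fun E => Finset.sum_nonneg fun i _ => dist_nonneg)
      ?_ h1
    filter_upwards [mem_inf_of_right (mem_principal_self _)] with E hE
    rw [Finset.mul_sum]
    refine Finset.sum_le_sum fun i hi => ?_
    have h2 := hE.1 i hi
    rw [uIcc_of_le hab] at h2
    exact hlip _ (hmem _ h2.1) _ (hmem _ h2.2)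
  · filter_upwards [hu.2] with x hx hxm
    exact (hφ _ (hmem x (Ioo_subset_Icc_self hxm))).comp x (hx hxm)

lemma congr_deriv {w : ℝ → ℝ} (hu : HasACDeriv u u' a b) (h : ∀ t ∈ Ioo a b, u' t = w t) :
    HasACDeriv u w a b := by
  refine ⟨hu.1, ?_⟩
  filter_upwards [hu.2] with x hx hxm
  exact h x hxm ▸ hx hxm

lemma le_of_ae_nonpos (hab : a ≤ b) (hu : HasACDeriv u u' a b)
    (hneg : ∀ᵐ t : ℝ, t ∈ Ioo a b → u' t ≤ 0) : u b ≤ u a := by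
  have h1 := hu.1.integral_deriv_eq_sub
  have h2 : ∫ x in a..b, deriv u x ≤ 0 := by
    rw [intervalIntegral.integral_of_le hab, MeasureTheory.integral_Ioc_eq_integral_Ioo]
    refine setIntegral_nonpos_ae measurableSet_Ioo ?_
    filter_upwards [hu.2, hneg] with x hx hx' hxm
    rw [(hx hxm).deriv]
    exact hx' hxm
  linarith

lemma antitoneOn_of_local (hc : ContinuousOn u (Icc a b))
    (hu : ∀ r t, a < r → r ≤ t → t < b → HasACDeriv u u' r t)
    (hneg : ∀ᵐ t : ℝ, t ∈ Ioo a b → u' t ≤ 0) : AntitoneOn u (Icc a b) := by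
  have h1 : AntitoneOn u (Ioo a b) := by
    intro r hr t ht hrt
    refine (hu r t hr.1 hrt ht.2).le_of_ae_nonpos hrt ?_
    filter_upwards [hneg] with x hx hxm
    exact hx ⟨hr.1.trans hxm.1, hxm.2.trans ht.2⟩
  have h2 : ∀ r ∈ Ioo a b, ∀ t ∈ Icc a b, r ≤ t → u t ≤ u r := by
    intro r hr t ht hrt
    rcases ht.2.lt_or_eq with h | h
    · exact h1 hr ⟨hr.1.trans_le hrt, h⟩ hrt
    · subst h
      have hlim : Tendsto u (𝓝[<] t) (𝓝 (u t)) :=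
        (hc t ht).mono_left (nhdsWithin_le_of_mem (Icc_mem_nhdsLT (hr.1.trans hr.2)))
      refine le_of_tendsto hlim ?_
      filter_upwards [Ioo_mem_nhdsLT hr.2] with x hx
      exact h1 hr ⟨hr.1.trans hx.1, hx.2⟩ hx.1.le
  intro r hr t ht hrt
  rcases hr.1.eq_or_lt with h | h
  · rcases hrt.eq_or_lt with h' | h'
    · rw [h']
    subst h
    have hlim : Tendsto u (𝓝[>] a) (𝓝 (u a)) :=
      (hc a hr).mono_left (nhdsWithin_le_of_mem (Icc_mem_nhdsGT (h'.trans_le ht.2)))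
    refine ge_of_tendsto hlim ?_
    filter_upwards [Ioo_mem_nhdsGT h'] with x hx
    exact h2 x ⟨hx.1, hx.2.trans_le ht.2⟩ t ht hx.2.le
  · rcases hrt.eq_or_lt with h' | h'
    · rw [h']
    exact h2 r ⟨h, h'.trans_le ht.2⟩ t ht hrt

/-- Maximum principle: a function starting nonpositive and nonincreasing wherever it is positive
stays nonpositive. -/
lemma nonpos_of_nonpos_where_pos (hc : ContinuousOn u (Icc a b)) (ha : u a ≤ 0)
    (hu : ∀ r t, a < r → r ≤ t → t < b → HasACDeriv u u' r t)
    (hneg : ∀ᵐ t : ℝ, t ∈ Ioo a b → 0 < u t → u' t ≤ 0) : ∀ t ∈ Icc a b, u t ≤ 0 := by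
  intro t1 ht1
  by_contra! hpos
  set S := Icc a t1 ∩ u ⁻¹' Iic 0 with hS
  have hsub : Icc a t1 ⊆ Icc a b := Icc_subset_Icc_right ht1.2
  have hcl : IsClosed S := (hc.mono hsub).preimage_isClosed_of_isClosed isClosed_Icc isClosed_Iic
  have hne : S.Nonempty := ⟨a, ⟨le_rfl, ht1.1⟩, ha⟩
  have hbdd : BddAbove S := ⟨t1, fun x hx => hx.1.2⟩
  have ht0 := hcl.csSup_mem hne hbdd
  set t0 := sSup S
  have hgt : ∀ t, t0 < t → t ≤ t1 → 0 < u t := by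
    intro t h1 h2
    by_contra! h3
    exact absurd (le_csSup hbdd ⟨⟨ht0.1.1.trans h1.le, h2⟩, h3⟩) (not_le.2 h1)
  have hanti : AntitoneOn u (Icc t0 t1) := by
    refine antitoneOn_of_local (hc.mono (Icc_subset_Icc ht0.1.1 ht1.2))
      (fun r t hr hrt ht => hu r t (ht0.1.1.trans_lt hr) hrt (ht.trans_le ht1.2)) ?_
    filter_upwards [hneg] with x hx hxm
    exact hx ⟨ht0.1.1.trans_lt hxm.1, hxm.2.trans_le ht1.2⟩ (hgt x hxm.1 hxm.2.le)
  have := hanti (left_mem_Icc.2 ht0.1.2) (right_mem_Icc.2 ht0.1.2) ht0.1.2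
  have h0 : u t0 ≤ 0 := ht0.2
  linarith

lemma lt_of_ae_neg (hab : a < b) (hc : ContinuousOn u (Icc a b))
    (hu : ∀ r t, a < r → r ≤ t → t < b → HasACDeriv u u' r t)
    (hneg : ∀ᵐ t : ℝ, t ∈ Ioo a b → u' t < 0) : u b < u a := by
  have hanti := antitoneOn_of_local hc hu (by
    filter_upwards [hneg] with x hx hxm using (hx hxm).le)
  have ha := left_mem_Icc.2 hab.le
  have hb := right_mem_Icc.2 hab.le
  refine (hanti ha hb hab.le).lt_of_ne fun heq => ?_
  have hconst : ∀ t ∈ Icc a b, u t = u a := fun t ht =>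
    le_antisymm (hanti ha ht ht.1) (heq ▸ hanti ht hb ht.2)
  obtain ⟨r, hr1, hr2⟩ := exists_between hab
  obtain ⟨t, ht1, ht2⟩ := exists_between hr2
  have hd := (hu r t hr1 ht1.le ht2).2
  have hex : ∃ x ∈ Ioo r t, HasDerivAt u (u' x) x ∧ u' x < 0 := by
    have hae : ∀ᵐ x ∂(volume.restrict (Ioo r t)), HasDerivAt u (u' x) x ∧ u' x < 0 := by
      rw [ae_restrict_iff' measurableSet_Ioo]
      filter_upwards [hd, hneg] with x h1 h2 hxm
      exact ⟨h1 hxm, h2 ⟨hr1.trans hxm.1, hxm.2.trans ht2⟩⟩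
    have : NeZero (volume.restrict (Ioo r t)) := ⟨by
      rw [Ne, Measure.restrict_eq_zero, Real.volume_Ioo]
      simpa using ht1⟩
    obtain ⟨x, hx, hxm⟩ := (hae.and (ae_restrict_mem measurableSet_Ioo)).exists
    exact ⟨x, hxm, hx⟩
  obtain ⟨x, hx, hdx, hnx⟩ := hex
  have h0 : HasDerivAt u 0 x := by
    refine (hasDerivAt_const x (u a)).congr_of_eventuallyEq ?_
    filter_upwards [isOpen_Ioo.mem_nhds hx] with z hz
    exact hconst z ⟨by linarith [hz.1], by linarith [hz.2]⟩
  exact hnx.ne (hdx.unique h0)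

end HasACDeriv

/-- The data of the problem on the half `[0, s]` of the unit interval where `f` is negative. -/
structure HalfData (p p' s : ℝ) (h f : ℝ → ℝ) : Prop where
  one_lt : 1 < p
  conj : p' = p / (p - 1)
  pos : 0 < s
  meas : Measurable h
  bdd : ∃ M : ℝ, ∀ t ∈ Icc (0 : ℝ) s, |h t| ≤ M
  int : IntervalIntegrable f volume 0 s
  neg : ∀ t ∈ Ioo (0 : ℝ) s, f t < 0
  usc : UpperSemicontinuousOn f (Ioo (0 : ℝ) s)

/-- The right-hand side of the ODE along a function `y`. -/
def odeRhs (p p' : ℝ) (h f : ℝ → ℝ) (c : ℝ) (y : ℝ → ℝ) (t : ℝ) : ℝ :=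
  p' * ((c - h t) * (max (y t) 0) ^ (1 / p) - f t)

/-- A solution on `[0, s]` that starts from `0`. -/
def IsHalfSol (p p' s : ℝ) (h f : ℝ → ℝ) (c : ℝ) (y : ℝ → ℝ) : Prop :=
  IsCaraSol p p' h f c 0 s y ∧ y 0 = 0

lemma intervalIntegrable_bdd_mul_continuousOn {k g : ℝ → ℝ} {a b M : ℝ} (hab : a ≤ b)
    (hk : Measurable k) (hM : ∀ t ∈ Icc a b, |k t| ≤ M) (hg : ContinuousOn g (Icc a b)) :
    IntervalIntegrable (fun t => k t * g t) volume a b := by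
  have hg' : IntervalIntegrable g volume a b := hg.intervalIntegrable_of_Icc hab
  rw [intervalIntegrable_iff_integrableOn_Ioc_of_le hab] at hg' ⊢
  refine hg'.bdd_mul hk.aestronglyMeasurable (c := M) ?_
  rw [ae_restrict_iff' measurableSet_Ioc]
  exact Eventually.of_forall fun t ht => hM t (Ioc_subset_Icc_self ht)

lemma intervalIntegrable_odeRhs {p p' c a b : ℝ} {h f y : ℝ → ℝ} (hp : 0 < p) (hab : a ≤ b)
    (hh : Measurable h) (hbd : ∃ M : ℝ, ∀ t ∈ Icc a b, |h t| ≤ M)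
    (hf : IntervalIntegrable f volume a b) (hy : ContinuousOn y (Icc a b)) :
    IntervalIntegrable (odeRhs p p' h f c y) volume a b := by
  obtain ⟨M, hM⟩ := hbd
  have hcont : ContinuousOn (fun t => (max (y t) 0) ^ (1 / p)) (Icc a b) :=
    (hy.sup continuousOn_const).rpow_const fun x _ => Or.inr (one_div_pos.2 hp).le
  have hM' : ∀ t ∈ Icc a b, |c - h t| ≤ |c| + M := fun t ht =>
    (abs_sub _ _).trans (by linarith [hM t ht])
  exact ((intervalIntegrable_bdd_mul_continuousOn hab (measurable_const.sub hh) hM'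
    hcont).sub hf).const_mul p'

namespace HalfData

variable {p p' s : ℝ} {h f : ℝ → ℝ} (d : HalfData p p' s h f)
include d

lemma conj_pos : 0 < p' := by
  rw [d.conj]; exact div_pos (by linarith [d.one_lt]) (by linarith [d.one_lt])

lemma one_lt_conj : 1 < p' := by
  have := d.one_lt
  rw [d.conj, one_lt_div (by linarith)]; linarith

lemma p_pos : 0 < p := by linarith [d.one_lt]

lemma one_div_conj : 1 / p' = 1 - 1 / p := by
  have := d.one_lt
  have h1 : p - 1 ≠ 0 := by linarith
  have h2 : p ≠ 0 := by linarith
  rw [d.conj]; field_simp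

lemma exists_abs_sub_le (c : ℝ) : ∃ M, 0 ≤ M ∧ ∀ t ∈ Icc (0 : ℝ) s, |c - h t| ≤ M := by
  obtain ⟨M, hM⟩ := d.bdd
  refine ⟨|c| + M, ?_, fun t ht => (abs_sub _ _).trans (by linarith [hM t ht])⟩
  linarith [hM 0 ⟨le_rfl, d.pos.le⟩, abs_nonneg (h 0), abs_nonneg c]

lemma intervalIntegrable_odeRhs (c : ℝ) {y : ℝ → ℝ} (hy : ContinuousOn y (Icc 0 s)) :
    IntervalIntegrable (odeRhs p p' h f c y) volume 0 s :=
  _root_.intervalIntegrable_odeRhs d.p_pos d.pos.le d.meas d.bdd d.int hy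

lemma hasACDeriv {c : ℝ} {y : ℝ → ℝ} (hy : IsHalfSol p p' s h f c y) :
    HasACDeriv y (odeRhs p p' h f c y) 0 s :=
  HasACDeriv.of_integral d.pos.le (d.intervalIntegrable_odeRhs c hy.1.1) hy.1.2

lemma nonneg {c : ℝ} {y : ℝ → ℝ} (hy : IsHalfSol p p' s h f c y) :
    ∀ t ∈ Icc (0 : ℝ) s, 0 ≤ y t := by
  have h1 : HasACDeriv (fun t => 0 * t - y t) (fun t => 0 - odeRhs p p' h f c y t) 0 s :=
    (HasACDeriv.linear 0 0 s d.pos.le).sub (d.hasACDeriv hy)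
  have h2 := HasACDeriv.nonpos_of_nonpos_where_pos (u := fun t => 0 * t - y t)
    (u' := fun t => 0 - odeRhs p p' h f c y t) (a := 0) (b := s)
    (by have := hy.1.1; fun_prop) (by simp [hy.2])
    (fun r t hr hrt ht => h1.mono hr.le hrt ht.le) ?_
  · intro t ht
    have := h2 t ht
    linarith
  · refine Eventually.of_forall fun t ht hpos => ?_
    have hyt : y t ≤ 0 := by linarith
    have hp : (1 / p) ≠ 0 := one_div_ne_zero d.p_pos.ne'
    simp only [odeRhs, max_eq_right hyt, Real.zero_rpow hp]
    have := mul_pos d.conj_pos (neg_pos.2 (d.neg t ht))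
    linarith

lemma sol_pos {c : ℝ} {y : ℝ → ℝ} (hy : IsHalfSol p p' s h f c y) :
    ∀ t ∈ Ioo (0 : ℝ) s, 0 < y t := by
  intro t1 ht1
  refine (d.nonneg hy t1 (Ioo_subset_Icc_self ht1)).lt_of_ne' fun hzero => ?_
  obtain ⟨M, hM0, hM⟩ := d.exists_abs_sub_le c
  have hft := d.neg t1 ht1
  have hp : 0 < 1 / p := one_div_pos.2 d.p_pos
  have hc : ContinuousAt y t1 := hy.1.1.continuousAt (Icc_mem_nhds ht1.1 ht1.2)
  have hlim : Tendsto (fun t => M * (max (y t) 0) ^ (1 / p)) (𝓝 t1) (𝓝 0) := by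
    have : ContinuousAt (fun t => M * (max (y t) 0) ^ (1 / p)) t1 :=
      continuousAt_const.mul ((hc.max continuousAt_const).rpow_const (Or.inr hp.le))
    rwa [ContinuousAt, hzero, max_self, Real.zero_rpow hp.ne', mul_zero] at this
  have hev1 : ∀ᶠ t in 𝓝 t1, M * (max (y t) 0) ^ (1 / p) < -(f t1 / 2) :=
    hlim.eventually_lt_const (by linarith)
  have hev2 : ∀ᶠ t in 𝓝 t1, f t < f t1 / 2 := by
    have := d.usc t1 ht1 (f t1 / 2) (by linarith)
    rwa [isOpen_Ioo.nhdsWithin_eq ht1] at this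
  obtain ⟨ε, hε, hball⟩ := Metric.eventually_nhds_iff.1
    ((hev1.and hev2).and (isOpen_Ioo.mem_nhds ht1))
  set r := t1 - ε / 2
  have hr : r ∈ Ioo 0 s := (hball (y := r) (by
    rw [Real.dist_eq, show r - t1 = -(ε / 2) by simp [r], abs_neg, abs_of_pos] <;> linarith)).2
  have hrt : r < t1 := by simp only [r]; linarith
  have h1 : HasACDeriv (fun t => 0 * t - y t) (fun t => 0 - odeRhs p p' h f c y t) 0 s :=
    (HasACDeriv.linear 0 0 s d.pos.le).sub (d.hasACDeriv hy)
  have hsub : Icc r t1 ⊆ Icc 0 s := Icc_subset_Icc hr.1.le ht1.2.le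
  have h2 := HasACDeriv.lt_of_ae_neg hrt (by have := hy.1.1.mono hsub; fun_prop)
    (fun a b ha hab hb => h1.mono (hr.1.trans ha).le hab (hb.trans ht1.2).le) ?_
  · have := d.nonneg hy r (Ioo_subset_Icc_self hr)
    linarith
  · refine Eventually.of_forall fun t ht => ?_
    have hb := hball (y := t) (by
      rw [Real.dist_eq, abs_lt]; have h6 : t1 - ε / 2 < t := ht.1
      constructor <;> linarith [ht.2])
    have h3 : -(M * (max (y t) 0) ^ (1 / p)) ≤ (c - h t) * (max (y t) 0) ^ (1 / p) := by
      have := (abs_le.1 (hM t (Ioo_subset_Icc_self hb.2))).1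
      have h4 : 0 ≤ (max (y t) 0) ^ (1 / p) := Real.rpow_nonneg (le_max_right _ _) _
      nlinarith
    have h5 : 0 < (c - h t) * (max (y t) 0) ^ (1 / p) - f t := by linarith [hb.1.1, hb.1.2]
    have := mul_pos d.conj_pos h5
    simp only [odeRhs]; linarith

lemma hasACDeriv_rpow {c : ℝ} {y : ℝ → ℝ} (hy : IsHalfSol p p' s h f c y) {a b : ℝ}
    (ha : 0 < a) (hab : a ≤ b) (hb : b < s) :
    HasACDeriv (fun t => y t ^ (1 / p')) (fun t => (c - h t) - f t * y t ^ (-(1 / p))) a b := by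
  have hsub : Icc a b ⊆ Ioo 0 s := fun t ht => ⟨ha.trans_le ht.1, ht.2.trans_lt hb⟩
  have hcont : ContinuousOn y (Icc a b) := hy.1.1.mono (hsub.trans Ioo_subset_Icc_self)
  obtain ⟨t0, ht0, hmin⟩ := isCompact_Icc.exists_isMinOn (nonempty_Icc.2 hab) hcont
  obtain ⟨t2, ht2, hmax⟩ := isCompact_Icc.exists_isMaxOn (nonempty_Icc.2 hab) hcont
  have hm : 0 < y t0 := d.sol_pos hy t0 (hsub ht0)
  have hq := d.one_div_conj
  have hp : 0 < 1 / p := one_div_pos.2 d.p_pos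
  have hq0 : 0 < 1 / p' := one_div_pos.2 d.conj_pos
  have h1 := ((d.hasACDeriv hy).mono ha.le hab hb.le).comp hab
    (φ := fun x => x ^ (1 / p')) (φ' := fun x => 1 / p' * x ^ (1 / p' - 1))
    (m := y t0) (N := y t2) (C := 1 / p' * y t0 ^ (1 / p' - 1))
    (fun t ht => ⟨hmin ht, hmax ht⟩)
    (fun x hx => Real.hasDerivAt_rpow_const (Or.inl (hm.trans_le hx.1).ne'))
    (fun x hx => by
      have hx0 := hm.trans_le hx.1
      rw [abs_of_nonneg (by positivity)]
      refine mul_le_mul_of_nonneg_left ?_ hq0.le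
      exact Real.rpow_le_rpow_of_nonpos hm hx.1 (by linarith))
  refine h1.congr_deriv fun t ht => ?_
  have hyt := d.sol_pos hy t (hsub (Ioo_subset_Icc_self ht))
  have e1 : 1 / p' - 1 = -(1 / p) := by linarith
  have e2 : y t ^ (-(1 / p)) * y t ^ (1 / p) = 1 := by
    rw [← Real.rpow_add hyt]; simp
  have e3 : 1 / p' * p' = 1 := by field_simp [d.conj_pos.ne']
  simp only [odeRhs, max_eq_left hyt.le, e1]
  linear_combination ((c - h t) * y t ^ (1 / p) - f t) * y t ^ (-(1 / p)) * e3 + (c - h t) * e2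

lemma continuousOn_rpow {c : ℝ} {y : ℝ → ℝ} (hy : IsHalfSol p p' s h f c y) :
    ContinuousOn (fun t => y t ^ (1 / p')) (Icc 0 s) :=
  hy.1.1.rpow_const fun _ _ => Or.inr (one_div_pos.2 d.conj_pos).le

/-- The power `1 / p'` of the solution is monotone and Lipschitz in `c`. -/
lemma rpow_sub_rpow_le {c₁ c₂ : ℝ} {y₁ y₂ : ℝ → ℝ} (h₁ : IsHalfSol p p' s h f c₁ y₁)
    (h₂ : IsHalfSol p p' s h f c₂ y₂) {t : ℝ} (ht : t ∈ Icc 0 s) :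
    y₂ t ^ (1 / p') - y₁ t ^ (1 / p') ≤ max (c₂ - c₁) 0 * t := by
  have hq0 : 0 < 1 / p' := one_div_pos.2 d.conj_pos
  have hp : 0 < 1 / p := one_div_pos.2 d.p_pos
  have c1 := d.continuousOn_rpow h₁
  have c2 := d.continuousOn_rpow h₂
  have key := HasACDeriv.nonpos_of_nonpos_where_pos
    (u := fun t => y₂ t ^ (1 / p') - y₁ t ^ (1 / p') - max (c₂ - c₁) 0 * t) (a := 0) (b := s)
    (by fun_prop) (by simp [h₁.2, h₂.2])
    (fun r t hr hrt ht => ((d.hasACDeriv_rpow h₂ hr hrt ht).sub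
      (d.hasACDeriv_rpow h₁ hr hrt ht)).sub (HasACDeriv.linear (max (c₂ - c₁) 0) r t hrt)) ?_ t ht
  · linarith
  · refine Eventually.of_forall fun x hx hpos => ?_
    have p1 := d.sol_pos h₁ x hx
    have p2 := d.sol_pos h₂ x hx
    have hm := le_max_left (c₂ - c₁) 0
    have hlt : y₁ x < y₂ x := by
      have : y₁ x ^ (1 / p') < y₂ x ^ (1 / p') := by
        have := mul_nonneg (le_max_right (c₂ - c₁) 0) hx.1.le
        linarith
      exact (Real.rpow_lt_rpow_iff p1.le p2.le hq0).1 this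
    have h3 : y₂ x ^ (-(1 / p)) ≤ y₁ x ^ (-(1 / p)) :=
      Real.rpow_le_rpow_of_nonpos p1 hlt.le (by linarith)
    have := d.neg x hx
    nlinarith

lemma sol_unique {c : ℝ} {y₁ y₂ : ℝ → ℝ} (h₁ : IsHalfSol p p' s h f c y₁)
    (h₂ : IsHalfSol p p' s h f c y₂) : EqOn y₁ y₂ (Icc 0 s) := by
  intro t ht
  have e1 := d.rpow_sub_rpow_le h₁ h₂ ht
  have e2 := d.rpow_sub_rpow_le h₂ h₁ ht
  simp only [sub_self, max_self, zero_mul] at e1 e2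
  exact (Real.rpow_left_inj (d.nonneg h₁ t ht) (d.nonneg h₂ t ht)
    (one_div_pos.2 d.conj_pos).ne').1 (by linarith)

lemma sol_mono {c₁ c₂ : ℝ} (hc : c₁ ≤ c₂) {y₁ y₂ : ℝ → ℝ} (h₁ : IsHalfSol p p' s h f c₁ y₁)
    (h₂ : IsHalfSol p p' s h f c₂ y₂) {t : ℝ} (ht : t ∈ Icc 0 s) : y₁ t ≤ y₂ t := by
  have e2 := d.rpow_sub_rpow_le h₂ h₁ ht
  rw [max_eq_right (by linarith), zero_mul] at e2
  exact (Real.rpow_le_rpow_iff (d.nonneg h₁ t ht) (d.nonneg h₂ t ht)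
    (one_div_pos.2 d.conj_pos)).1 (by linarith)

/-- If the solution vanishes at `s`, then the integral of `c - h` over each `[t, s]` is
negative. -/
lemma integral_neg_of_sol_end_eq_zero {c : ℝ} {y : ℝ → ℝ} (hy : IsHalfSol p p' s h f c y)
    (hys : y s = 0) {t : ℝ} (ht0 : 0 ≤ t) (hts : t < s) : ∫ τ in t..s, (c - h τ) < 0 := by
  obtain ⟨M, hM0, hM⟩ := d.exists_abs_sub_le c
  have hint : IntervalIntegrable (fun τ => c - h τ) volume 0 s := by
    simpa using intervalIntegrable_bdd_mul_continuousOn d.pos.le (measurable_const.sub d.meas) hM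
      (continuousOn_const (c := (1 : ℝ)))
  have hJ : HasACDeriv (fun x => ∫ τ in (0 : ℝ)..x, (c - h τ)) (fun x => c - h x) 0 s :=
    HasACDeriv.of_integral d.pos.le hint fun x _ => by simp
  have hJc : ContinuousOn (fun x => ∫ τ in (0 : ℝ)..x, (c - h τ)) (Icc t s) := by
    have := hJ.1.continuousOn
    rw [uIcc_of_le d.pos.le] at this
    exact this.mono (Icc_subset_Icc_left ht0)
  have hwc := (d.continuousOn_rpow hy).mono (Icc_subset_Icc_left ht0)
  have hlt := HasACDeriv.lt_of_ae_neg
    (u := fun x => (∫ τ in (0 : ℝ)..x, (c - h τ)) - y x ^ (1 / p')) hts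
    (hJc.sub hwc)
    (fun a b ha hab hb => (hJ.mono (ht0.trans ha.le) hab hb.le).sub
      (d.hasACDeriv_rpow hy (ht0.trans_lt ha) hab hb)) ?_
  · have e1 : (∫ τ in (0 : ℝ)..t, (c - h τ)) + ∫ τ in t..s, (c - h τ) =
        ∫ τ in (0 : ℝ)..s, (c - h τ) := by
      have htm : t ∈ uIcc 0 s := by rw [uIcc_of_le d.pos.le]; exact ⟨ht0, hts.le⟩
      exact intervalIntegral.integral_add_adjacent_intervals
        (hint.mono_set (uIcc_subset_uIcc_left htm)) (hint.mono_set (uIcc_subset_uIcc_right htm))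
    have e2 : 0 ≤ y t ^ (1 / p') := Real.rpow_nonneg (d.nonneg hy t ⟨ht0, hts.le⟩) _
    have e3 : y s ^ (1 / p') = 0 := by
      rw [hys, Real.zero_rpow (one_div_pos.2 d.conj_pos).ne']
    simp only [e3] at hlt
    linarith
  · refine Eventually.of_forall fun x hx => ?_
    have hx' : x ∈ Ioo 0 s := ⟨ht0.trans_lt hx.1, hx.2⟩
    have := mul_pos (neg_pos.2 (d.neg x hx')) (Real.rpow_pos_of_pos (d.sol_pos hy x hx') (-(1 / p)))
    linarith

/-- Estimate of the speed: for small `c` the solution vanishes at `s`. -/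
lemma sol_end_nonpos {c H μ : ℝ} {y : ℝ → ℝ} (hy : IsHalfSol p p' s h f c y)
    (hH : ∀ t ∈ Icc (0 : ℝ) s, H ≤ h t) (hμ : ∀ t ∈ Ioo (0 : ℝ) s, -f t ≤ μ * (s - t) ^ (p' - 1))
    (hμ0 : 0 < μ) (hc : c ≤ H - p' ^ (1 / p') * p ^ (1 / p) * μ ^ (1 / p')) : y s ≤ 0 := by
  have hp := d.p_pos
  have hp' := d.conj_pos
  have hp1 := d.one_lt_conj
  have hq := d.one_div_conj
  set A := ((p' - 1) * μ) ^ (1 / p') with hA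
  have hbase : 0 < (p' - 1) * μ := mul_pos (by linarith) hμ0
  have hA0 : 0 < A := Real.rpow_pos_of_pos hbase _
  have hAp : A ^ p' = (p' - 1) * μ := by
    rw [hA, ← Real.rpow_mul hbase.le, one_div_mul_cancel hp'.ne', Real.rpow_one]
  have hpp : p' - 1 = p' / p := by
    have := d.one_lt
    have h1 : p - 1 ≠ 0 := by linarith
    rw [d.conj]; field_simp; ring
  have hκ : p' ^ (1 / p') * p ^ (1 / p) * μ ^ (1 / p') = A * p := by
    have e : p = p ^ (1 / p) * p ^ (1 / p') := by
      rw [← Real.rpow_add hp, hq]; simp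
    have e0 : p ^ (1 / p') ≠ 0 := (Real.rpow_pos_of_pos hp _).ne'
    rw [hA, hpp, Real.mul_rpow (by positivity) hμ0.le, Real.div_rpow hp'.le hp.le]
    nth_rewrite 4 [e]
    field_simp
  rw [hκ] at hc
  have hYd : ∀ t ∈ Ioo (0 : ℝ) s, HasDerivAt (fun t => (A * (s - t)) ^ p')
      (-(p' * A * (A * (s - t)) ^ (p' - 1))) t := by
    intro t ht
    have h1 : HasDerivAt (fun t => A * (s - t)) (A * (-1)) t :=
      ((hasDerivAt_id t).const_sub s).const_mul A
    have h2 := h1.rpow_const (p := p') (Or.inr hp1.le)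
    convert h2 using 1; ring
  have hYc : Continuous (fun t => (A * (s - t)) ^ p') :=
    (by fun_prop : Continuous fun t => A * (s - t)).rpow_const fun _ => Or.inr hp'.le
  have hYac : ∀ r t, 0 < r → r ≤ t → t < s → HasACDeriv (fun t => (A * (s - t)) ^ p')
      (fun t => -(p' * A * (A * (s - t)) ^ (p' - 1))) r t := by
    intro r t hr hrt hts
    have hci : Continuous (fun t => -(p' * A * (A * (s - t)) ^ (p' - 1))) :=
      (((by fun_prop : Continuous fun t => A * (s - t)).rpow_const
        fun _ => Or.inr (by linarith)).const_mul (p' * A)).neg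
    refine HasACDeriv.of_integral hrt (hci.intervalIntegrable _ _) fun x hx => ?_
    rw [intervalIntegral.integral_eq_sub_of_hasDerivAt (f := fun t => (A * (s - t)) ^ p')
      _ (hci.intervalIntegrable _ _)]
    · ring
    · intro z hz
      rw [uIcc_of_le hx.1] at hz
      exact hYd z ⟨hr.trans_le hz.1, (hz.2.trans hx.2).trans_lt hts⟩
  have hyc := hy.1.1
  have hYc' := hYc.continuousOn (s := Icc 0 s)
  have key := HasACDeriv.nonpos_of_nonpos_where_pos
    (u := fun t => y t - (A * (s - t)) ^ p') (a := 0) (b := s)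
    (hyc.sub hYc')
    (by
      have := Real.rpow_nonneg (mul_nonneg hA0.le d.pos.le) p'
      simpa [hy.2] using this)
    (fun r t hr hrt ht => ((d.hasACDeriv hy).mono hr.le hrt ht.le).sub (hYac r t hr hrt ht)) ?_
    s (right_mem_Icc.2 d.pos.le)
  · simpa [Real.zero_rpow hp'.ne'] using key
  · refine Eventually.of_forall fun t ht hpos => ?_
    have hst : 0 < s - t := by linarith [ht.2]
    have hX : 0 < A * (s - t) := mul_pos hA0 hst
    have hyt := d.sol_pos hy t ht
    have e1 : A * (s - t) * (A * (s - t)) ^ (p' - 1) = (A * (s - t)) ^ p' := by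
      nth_rewrite 1 [← Real.rpow_one (A * (s - t))]
      rw [← Real.rpow_add hX]; congr 1; ring
    have e2 : ((A * (s - t)) ^ p') ^ (1 / p) = (A * (s - t)) ^ (p' - 1) := by
      rw [← Real.rpow_mul hX.le, hpp]; congr 1; ring
    have e3 : (A * (s - t)) ^ (p' - 1) ≤ y t ^ (1 / p) := by
      rw [← e2]
      exact Real.rpow_le_rpow (Real.rpow_nonneg hX.le _) (by linarith) (one_div_pos.2 hp).le
    have e4 : (A * (s - t)) ^ (p' - 1) = A ^ (p' - 1) * (s - t) ^ (p' - 1) :=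
      Real.mul_rpow hA0.le hst.le
    have e5 : A * A ^ (p' - 1) = (p' - 1) * μ := by
      rw [← hAp]; nth_rewrite 1 [← Real.rpow_one A]
      rw [← Real.rpow_add hA0]; congr 1; ring
    have hch : c - h t ≤ -(A * p) := by linarith [hH t (Ioo_subset_Icc_self ht)]
    have hZ : 0 < (A * (s - t)) ^ (p' - 1) := Real.rpow_pos_of_pos hX _
    have hAp0 : 0 < A * p := mul_pos hA0 hp
    have e6 : (c - h t) * y t ^ (1 / p) ≤ -(A * p) * (A * (s - t)) ^ (p' - 1) := by
      nlinarith
    have e7 : μ * (s - t) ^ (p' - 1) * (p' - 1) = A * (A * (s - t)) ^ (p' - 1) := by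
      rw [e4]; linear_combination -(s - t) ^ (p' - 1) * e5
    have e8 : (p - 1) * (p' - 1) = 1 := by
      have := d.one_lt
      have h1 : p - 1 ≠ 0 := by linarith
      rw [d.conj]; field_simp; ring
    have e9 : μ * (s - t) ^ (p' - 1) = A * (p - 1) * (A * (s - t)) ^ (p' - 1) := by
      linear_combination (p - 1) * e7 - μ * (s - t) ^ (p' - 1) * e8
    have e10 := hμ t ht
    have e11 : (c - h t) * y t ^ (1 / p) - f t ≤ -(A * (A * (s - t)) ^ (p' - 1)) := by
      rw [e9] at e10; linarith
    simp only [odeRhs, max_eq_left hyt.le]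
    nlinarith

end HalfData

/-- The integral operator of `y' = k φ(y) + g`, `y 0 = 0`, with the argument of `y` delayed by
`δ`. -/
def tonelliStep (k g φ : ℝ → ℝ) (δ : ℝ) (y : ℝ → ℝ) (t : ℝ) : ℝ :=
  ∫ τ in (0 : ℝ)..max t 0, (k τ * φ (y (τ - δ)) + g τ)

section Peano

variable {k g φ : ℝ → ℝ} {K B δ : ℝ}

lemma integrable_delayed (hk : Measurable k) (hg : Integrable g) (hkK : ∀ t, |k t| ≤ K)
    (hφ : Continuous φ) (hB : ∀ x, |φ x| ≤ B) {y : ℝ → ℝ} (hy : Continuous y) (a b : ℝ) :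
    IntervalIntegrable (fun τ => k τ * φ (y (τ - δ)) + g τ) volume a b := by
  refine IntervalIntegrable.add ?_ hg.intervalIntegrable
  rw [intervalIntegrable_iff]
  have hc : Continuous fun τ => φ (y (τ - δ)) := by fun_prop
  refine Measure.integrableOn_of_bounded (M := K * B) (by simp)
    (hk.mul hc.measurable).aestronglyMeasurable (Eventually.of_forall fun t => ?_)
  rw [norm_mul]
  exact mul_le_mul (hkK t) (hB _) (abs_nonneg _) ((abs_nonneg _).trans (hkK 0))

lemma abs_tonelliStep_sub_le (hk : Measurable k) (hg : Integrable g) (hkK : ∀ t, |k t| ≤ K)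
    (hφ : Continuous φ) (hB : ∀ x, |φ x| ≤ B) {y : ℝ → ℝ} (hy : Continuous y) (t t' : ℝ) :
    |tonelliStep k g φ δ y t - tonelliStep k g φ δ y t'| ≤
      |(∫ τ in (0 : ℝ)..max t 0, (K * B + |g τ|)) - ∫ τ in (0 : ℝ)..max t' 0, (K * B + |g τ|)| := by
  have hI := integrable_delayed (δ := δ) hk hg hkK hφ hB hy
  have hJ : ∀ a b, IntervalIntegrable (fun τ => K * B + |g τ|) volume a b := fun a b =>
    intervalIntegrable_const.add hg.abs.intervalIntegrable
  rw [tonelliStep, tonelliStep, intervalIntegral.integral_interval_sub_left (hI _ _) (hI _ _),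
    intervalIntegral.integral_interval_sub_left (hJ _ _) (hJ _ _)]
  rw [← Real.norm_eq_abs]
  refine intervalIntegral.norm_integral_le_abs_of_norm_le (Eventually.of_forall fun τ => ?_) (hJ _ _)
  refine (norm_add_le _ _).trans (add_le_add ?_ le_rfl)
  rw [norm_mul]
  exact mul_le_mul (hkK τ) (hB _) (abs_nonneg _) ((abs_nonneg _).trans (hkK 0))

lemma continuous_primitive_max {F : ℝ → ℝ} (hF : ∀ a b, IntervalIntegrable F volume a b) :
    Continuous fun t : ℝ => ∫ τ in (0 : ℝ)..max t 0, F τ :=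
  (intervalIntegral.continuous_primitive hF 0).comp (continuous_id.max continuous_const)

lemma exists_delayed_solution (hk : Measurable k) (hg : Integrable g) (hkK : ∀ t, |k t| ≤ K)
    (hφ : Continuous φ) (hB : ∀ x, |φ x| ≤ B) (hδ : 0 < δ) (s : ℝ) :
    ∃ y : ℝ → ℝ, Continuous y ∧ (∀ t ≤ s, y t = tonelliStep k g φ δ y t) ∧
      ∃ z : ℝ → ℝ, Continuous z ∧ y = tonelliStep k g φ δ z := by
  set Y : ℕ → ℝ → ℝ := fun n => (tonelliStep k g φ δ)^[n] 0 with hY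
  have hsucc : ∀ n, Y (n + 1) = tonelliStep k g φ δ (Y n) := fun n =>
    Function.iterate_succ_apply' _ _ _
  have hcont : ∀ n, Continuous (Y n) := by
    intro n
    induction n with
    | zero => exact continuous_const
    | succ n ih =>
      rw [hsucc]
      exact continuous_primitive_max (integrable_delayed (δ := δ) hk hg hkK hφ hB ih)
  have hstab : ∀ n : ℕ, ∀ t : ℝ, t ≤ n * δ → Y (n + 1) t = Y n t := by
    intro n
    induction n with
    | zero =>
      intro t ht
      simp only [Nat.cast_zero, zero_mul] at ht
      rw [hsucc, tonelliStep, max_eq_right ht]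
      simp [hY]
    | succ n ih =>
      intro t ht
      rw [hsucc, hsucc n, tonelliStep, tonelliStep]
      refine intervalIntegral.integral_congr fun τ hτ => ?_
      rw [uIcc_of_le (le_max_right _ _)] at hτ
      have h1 : τ - δ ≤ n * δ := by
        push_cast at ht
        have hn : (0 : ℝ) ≤ n * δ := by positivity
        rcases le_max_iff.1 hτ.2 with h | h <;> linarith
      simp only [← hsucc, ih _ h1]
  obtain ⟨N, hN⟩ := exists_nat_ge (s / δ)
  refine ⟨Y (N + 1), hcont _, fun t ht => ?_, Y N, hcont _, hsucc N⟩
  have h1 : t ≤ N * δ := ht.trans ((div_le_iff₀ hδ).1 hN)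
  rw [← hsucc, hstab (N + 1) t (by push_cast; linarith)]

/-- **Peano's existence theorem** under Carathéodory conditions, for a bounded nonlinearity. -/
lemma exists_solution_of_bounded (hk : Measurable k) (hg : Integrable g) (hkK : ∀ t, |k t| ≤ K)
    (hφ : Continuous φ) (hB : ∀ x, |φ x| ≤ B) {s : ℝ} (hs : 0 < s) :
    ∃ y : ℝ → ℝ, Continuous y ∧ ∀ t ∈ Icc 0 s, y t = ∫ τ in (0 : ℝ)..t, (k τ * φ (y τ) + g τ) := by
  have hJ : ∀ a b, IntervalIntegrable (fun τ => K * B + |g τ|) volume a b := fun a b =>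
    intervalIntegrable_const.add hg.abs.intervalIntegrable
  set G : ℝ → ℝ := fun t => ∫ τ in (0 : ℝ)..max t 0, (K * B + |g τ|) with hG
  have hGc : Continuous G := continuous_primitive_max hJ
  set δ : ℕ → ℝ := fun n => 1 / ((n : ℝ) + 1)
  have hδ : ∀ n, 0 < δ n := fun n => Nat.one_div_pos_of_nat
  choose Y hYc hYeq Z hZc hYZ using fun n =>
    exists_delayed_solution hk hg hkK hφ hB (hδ n) s
  have hYG : ∀ n t t', |Y n t - Y n t'| ≤ |G t - G t'| := by
    intro n t t'
    rw [hYZ n]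
    exact abs_tonelliStep_sub_le hk hg hkK hφ hB (hZc n) t t'
  have hY0 : ∀ n, Y n 0 = 0 := by
    intro n; rw [hYZ n]; simp [tonelliStep]
  obtain ⟨C, hC⟩ := (isCompact_Icc (a := (0 : ℝ)) (b := s)).exists_bound_of_continuousOn
    (f := fun t => G t - G 0) (by fun_prop)
  set X : ℕ → BoundedContinuousFunction (Icc (0 : ℝ) s) ℝ := fun n =>
    BoundedContinuousFunction.mkOfCompact ⟨fun t => Y n t, (hYc n).comp continuous_subtype_val⟩
  have hcpt : IsCompact (closure (range X)) := by
    refine BoundedContinuousFunction.arzela_ascoli (Icc (-C) C) isCompact_Icc _ ?_ ?_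
    · rintro _ t ⟨n, rfl⟩
      have h1 := hYG n t 0
      rw [hY0, sub_zero] at h1
      exact abs_le.1 (h1.trans (hC t t.2))
    · intro t
      refine Metric.equicontinuousAt_of_continuity_modulus
        (fun x : Icc (0 : ℝ) s => |G t - G x|) ?_ _ ?_
      · have h1 : Continuous fun x : Icc (0 : ℝ) s => |G t - G x| := by fun_prop
        simpa using h1.tendsto t
      · refine Eventually.of_forall fun x => ?_
        rintro ⟨_, n, rfl⟩
        exact hYG n t x
  obtain ⟨L, -, ψ, hψ, hlim⟩ := hcpt.tendsto_subseq fun n => subset_closure (mem_range_self n)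
  have hpt : ∀ t : Icc (0 : ℝ) s, Tendsto (fun n => Y (ψ n) t) atTop (𝓝 (L t)) := fun t =>
    ((BoundedContinuousFunction.lipschitz_eval_const t).continuous.tendsto L).comp hlim
  refine ⟨IccExtend hs.le L, L.continuous.Icc_extend', fun t ht => ?_⟩
  rw [IccExtend_of_mem _ _ ht]
  refine tendsto_nhds_unique (hpt ⟨t, ht⟩) ?_
  have hform : ∀ n, Y (ψ n) t =
      ∫ τ in (0 : ℝ)..t, (k τ * φ (Y (ψ n) (τ - δ (ψ n))) + g τ) := by
    intro n
    conv_lhs => rw [hYeq _ t ht.2, tonelliStep, max_eq_left ht.1]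
  simp only [hform]
  have hδ0 : Tendsto (fun n => δ (ψ n)) atTop (𝓝 0) :=
    tendsto_one_div_add_atTop_nhds_zero_nat.comp hψ.tendsto_atTop
  refine intervalIntegral.tendsto_integral_filter_of_dominated_convergence
    (fun τ => K * B + |g τ|) (Eventually.of_forall fun n => ?_)
    (Eventually.of_forall fun n => Eventually.of_forall fun τ _ => ?_) (hJ _ _)
    (Eventually.of_forall fun τ hτ => ?_)
  · exact (intervalIntegrable_iff.1
      (integrable_delayed hk hg hkK hφ hB (hYc (ψ n)) 0 t)).aestronglyMeasurable
  · refine (norm_add_le _ _).trans (add_le_add ?_ le_rfl)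
    rw [norm_mul]
    exact mul_le_mul (hkK τ) (hB _) (abs_nonneg _) ((abs_nonneg _).trans (hkK 0))
  · rw [uIoc_of_le ht.1] at hτ
    have hτm : τ ∈ Icc 0 s := ⟨hτ.1.le, hτ.2.trans ht.2⟩
    rw [IccExtend_of_mem _ _ hτm]
    have h1 := hpt ⟨τ, hτm⟩
    have h2 : Tendsto (fun n => Y (ψ n) (τ - δ (ψ n)) - Y (ψ n) τ) atTop (𝓝 0) := by
      refine squeeze_zero_norm (fun n => hYG _ _ _) ?_
      have h3 : Tendsto (fun n => τ - δ (ψ n)) atTop (𝓝 τ) := by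
        simpa using hδ0.const_sub τ
      have h4 := ((hGc.tendsto τ).comp h3).sub_const (G τ)
      simpa using h4.abs
    have h5 : Tendsto (fun n => Y (ψ n) (τ - δ (ψ n))) atTop (𝓝 (L ⟨τ, hτm⟩)) := by
      simpa using h2.add h1
    exact (((hφ.tendsto _).comp h5).const_mul _).add_const _

end Peano

namespace HalfData

variable {p p' s : ℝ} {h f : ℝ → ℝ} (d : HalfData p p' s h f)
include d

lemma exists_sol (c : ℝ) : ∃ y, IsHalfSol p p' s h f c y := by
  obtain ⟨M, hM0, hM⟩ := d.exists_abs_sub_le c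
  have hp' := d.conj_pos
  have hp := d.p_pos
  have hfi := d.int
  rw [intervalIntegrable_iff_integrableOn_Ioc_of_le d.pos.le] at hfi
  set k : ℝ → ℝ := (Ioc 0 s).indicator fun t => p' * (c - h t) with hkdef
  set g : ℝ → ℝ := (Ioc 0 s).indicator fun t => -(p' * f t) with hgdef
  have hk : Measurable k :=
    ((measurable_const.sub d.meas).const_mul p').indicator measurableSet_Ioc
  have hg : Integrable g :=
    (integrable_indicator_iff measurableSet_Ioc).2 (hfi.const_mul p').neg
  have hkK : ∀ t, |k t| ≤ p' * M := by
    intro t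
    by_cases ht : t ∈ Ioc 0 s
    · rw [hkdef, indicator_of_mem ht, abs_mul, abs_of_pos hp']
      exact mul_le_mul_of_nonneg_left (hM t (Ioc_subset_Icc_self ht)) hp'.le
    · rw [hkdef, indicator_of_notMem ht, abs_zero]; positivity
  set D : ℝ := p' * M * s + (∫ τ in (0 : ℝ)..s, |g τ|) + 1 with hD
  have hgi : 0 ≤ ∫ τ in (0 : ℝ)..s, |g τ| :=
    intervalIntegral.integral_nonneg d.pos.le fun _ _ => abs_nonneg _
  have hMs : 0 ≤ p' * M * s := mul_nonneg (mul_nonneg hp'.le hM0) d.pos.le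
  have hD1 : 1 ≤ D := by linarith
  set R : ℝ := D ^ p'
  have hR0 : 0 ≤ R := Real.rpow_nonneg (by linarith) _
  set B : ℝ := R ^ (1 / p) with hBdef
  have hB1 : 1 ≤ B := Real.one_le_rpow (Real.one_le_rpow hD1 hp'.le) (one_div_pos.2 hp).le
  have hDB : D * B = R := by
    have hD0 : 0 < D := by linarith
    have e : 1 + p' * (1 / p) = p' := by
      have := d.one_lt
      have h1 : p - 1 ≠ 0 := by linarith
      rw [d.conj]; field_simp; ring
    rw [hBdef, ← Real.rpow_mul hD0.le]
    nth_rewrite 1 [← Real.rpow_one D]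
    rw [← Real.rpow_add hD0, e]
  set φ : ℝ → ℝ := fun x => (min (max x 0) R) ^ (1 / p)
  have hφc : Continuous φ :=
    ((continuous_id.max continuous_const).min continuous_const).rpow_const
      fun _ => Or.inr (one_div_pos.2 hp).le
  have hφB : ∀ x, |φ x| ≤ B := by
    intro x
    have h0 : 0 ≤ min (max x 0) R := le_min (le_max_right _ _) hR0
    rw [abs_of_nonneg (Real.rpow_nonneg h0 _)]
    exact Real.rpow_le_rpow h0 (min_le_right _ _) (one_div_pos.2 hp).le
  obtain ⟨y, hyc, hy⟩ := exists_solution_of_bounded hk hg hkK hφc hφB d.pos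
  have hy0 : y 0 = 0 := by rw [hy 0 ⟨le_rfl, d.pos.le⟩]; simp
  have hbound : ∀ t ∈ Icc 0 s, y t ≤ R := by
    intro t ht
    have hJ : ∀ a b, IntervalIntegrable (fun τ => p' * M * B + |g τ|) volume a b := fun a b =>
      intervalIntegrable_const.add hg.abs.intervalIntegrable
    calc y t ≤ ‖y t‖ := Real.le_norm_self _
      _ = ‖∫ τ in (0 : ℝ)..t, (k τ * φ (y τ) + g τ)‖ := by rw [hy t ht]
      _ ≤ ∫ τ in (0 : ℝ)..t, (p' * M * B + |g τ|) := by
        refine intervalIntegral.norm_integral_le_of_norm_le ht.1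
          (Eventually.of_forall fun τ _ => ?_) (hJ _ _)
        refine (norm_add_le _ _).trans (add_le_add ?_ le_rfl)
        rw [norm_mul]
        exact mul_le_mul (hkK τ) (hφB _) (abs_nonneg _) ((abs_nonneg _).trans (hkK 0))
      _ ≤ ∫ τ in (0 : ℝ)..s, (p' * M * B + |g τ|) := by
        refine intervalIntegral.integral_mono_interval le_rfl ht.1 ht.2
          (Eventually.of_forall fun τ => ?_) (hJ _ _)
        have := abs_nonneg (g τ)
        have : 0 ≤ p' * M * B := by positivity
        simp only [Pi.zero_apply]; linarith
      _ = p' * M * B * s + ∫ τ in (0 : ℝ)..s, |g τ| := by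
        rw [intervalIntegral.integral_add intervalIntegrable_const hg.abs.intervalIntegrable]
        simp; ring
      _ ≤ D * B := by rw [hD]; nlinarith
      _ = R := hDB
  refine ⟨y, ⟨hyc.continuousOn, fun t ht => ?_⟩, hy0⟩
  rw [hy0, zero_add, hy t ht]
  refine intervalIntegral.integral_congr_ae (Eventually.of_forall fun τ hτ => ?_)
  rw [uIoc_of_le ht.1] at hτ
  have hτ' : τ ∈ Ioc 0 s := ⟨hτ.1, hτ.2.trans ht.2⟩
  have hle : max (y τ) 0 ≤ R := max_le (hbound τ (Ioc_subset_Icc_self hτ')) hR0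
  simp only [hkdef, hgdef, φ, indicator_of_mem hτ', min_eq_left hle]
  ring

/-- The end value of the solution tends to `0` as `c → -∞`. -/
lemma exists_sol_end_lt {ε : ℝ} (hε : 0 < ε) :
    ∃ c₀ : ℝ, ∀ c ≤ c₀, ∀ y, IsHalfSol p p' s h f c y → y s < ε := by
  obtain ⟨M, hM⟩ := d.bdd
  have hp' := d.conj_pos
  have hp := d.p_pos
  have hss : s ∈ Icc 0 s := right_mem_Icc.2 d.pos.le
  have hfi : IntervalIntegrable (fun τ => -(p' * f τ)) volume 0 s := (d.int.const_mul p').neg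
  set J : ℝ → ℝ := fun t => ∫ τ in (0 : ℝ)..t, -(p' * f τ) with hJdef
  have hJ : HasACDeriv J (fun t => -(p' * f t)) 0 s :=
    HasACDeriv.of_integral d.pos.le hfi fun t _ => by simp [hJdef]
  have hJ0 : J 0 = 0 := by simp [hJdef]
  have hJc : ContinuousOn J (Icc 0 s) := by
    have := hJ.1.continuousOn
    rwa [uIcc_of_le d.pos.le] at this
  have hJmono : ∀ r ∈ Icc 0 s, ∀ t ∈ Icc 0 s, r ≤ t → J r ≤ J t := by
    intro r hr t ht hrt
    have := (((HasACDeriv.linear 0 0 s d.pos.le).sub hJ).mono hr.1 hrt ht.2).le_of_ae_nonpos hrt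
      (Eventually.of_forall fun x hx => by
        have := mul_pos hp' (neg_pos.2 (d.neg x ⟨hr.1.trans_lt hx.1, hx.2.trans_le ht.2⟩))
        linarith)
    linarith
  obtain ⟨t₀, hJt₀, ht₀⟩ : ∃ t₀, J s - J t₀ < ε / 2 ∧ t₀ ∈ Ioo 0 s := by
    have h1 : Tendsto (fun t => J s - J t) (𝓝[<] s) (𝓝 (J s - J s)) :=
      ((hJc s hss).mono_left (nhdsWithin_le_of_mem (Icc_mem_nhdsLT d.pos))).const_sub _
    rw [sub_self] at h1
    exact ((h1.eventually_lt_const (half_pos hε)).and (Ioo_mem_nhdsLT d.pos)).exists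
  have ht₀' := Ioo_subset_Icc_self ht₀
  have hJs : 0 ≤ J s := hJ0 ▸ hJmono 0 ⟨le_rfl, d.pos.le⟩ s hss d.pos.le
  set η := (ε / 2) ^ (1 / p) with hη
  have hη0 : 0 < η := Real.rpow_pos_of_pos (half_pos hε) _
  have hw : 0 < s - t₀ := by linarith [ht₀.2]
  set N := (J s + 1) / (p' * η * (s - t₀)) with hN
  have hN0 : 0 ≤ N := div_nonneg (by linarith) (by positivity)
  refine ⟨-M - N, fun c hc y hy => ?_⟩
  by_contra! hge
  have hneg : ∀ t ∈ Icc 0 s, c - h t ≤ -N := fun t ht => by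
    linarith [(abs_le.1 (hM t ht)).1]
  have hu := (d.hasACDeriv hy).sub hJ
  have hpow : ∀ t, 0 ≤ (max (y t) 0) ^ (1 / p) := fun t =>
    Real.rpow_nonneg (le_max_right _ _) _
  have hanti : ∀ r ∈ Icc 0 s, ∀ t ∈ Icc 0 s, r ≤ t → y t - J t ≤ y r - J r := by
    intro r hr t ht hrt
    refine (hu.mono hr.1 hrt ht.2).le_of_ae_nonpos hrt (Eventually.of_forall fun x hx => ?_)
    have h1 := hneg x ⟨hr.1.trans hx.1.le, hx.2.le.trans ht.2⟩
    have h2 : (c - h x) * (max (y x) 0) ^ (1 / p) ≤ 0 :=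
      mul_nonpos_of_nonpos_of_nonneg (by linarith) (hpow x)
    have := mul_nonpos_of_nonneg_of_nonpos hp'.le h2
    simp only [odeRhs]; linarith
  have hlow : ∀ t ∈ Icc t₀ s, ε / 2 ≤ y t := by
    intro t ht
    have ht' : t ∈ Icc 0 s := ⟨ht₀.1.le.trans ht.1, ht.2⟩
    linarith [hanti t ht' s hss ht.2, hJmono t₀ ht₀' t ht' ht.1]
  have hdrop := ((hu.mono ht₀.1.le ht₀.2.le le_rfl).sub
      (HasACDeriv.linear (-(p' * (N * η))) t₀ s ht₀.2.le)).le_of_ae_nonpos ht₀.2.le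
      (Eventually.of_forall fun x hx => by
    have h1 := hneg x ⟨ht₀.1.le.trans hx.1.le, hx.2.le⟩
    have h2 : η ≤ (max (y x) 0) ^ (1 / p) :=
      Real.rpow_le_rpow (half_pos hε).le
        ((hlow x (Ioo_subset_Icc_self hx)).trans (le_max_left _ _)) (one_div_pos.2 hp).le
    have h3 : (c - h x) * (max (y x) 0) ^ (1 / p) ≤ -(N * η) := by nlinarith
    have := mul_le_mul_of_nonneg_left h3 hp'.le
    simp only [odeRhs]; linarith)
  have hNη : p' * (N * η) * (s - t₀) = J s + 1 := by
    rw [hN]; field_simp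
  have h0 := hanti 0 ⟨le_rfl, d.pos.le⟩ t₀ ht₀' ht₀.1.le
  rw [hy.2, hJ0] at h0
  linarith

/-- For large `c` the solution does not vanish at `s`. -/
lemma exists_sol_end_pos : ∃ c : ℝ, ∀ y, IsHalfSol p p' s h f c y → 0 < y s := by
  obtain ⟨M, hM⟩ := d.bdd
  refine ⟨M, fun y hy => ?_⟩
  have h1 : HasACDeriv (fun t => 0 * t - y t) (fun t => 0 - odeRhs p p' h f M y t) 0 s :=
    (HasACDeriv.linear 0 0 s d.pos.le).sub (d.hasACDeriv hy)
  have h2 := HasACDeriv.lt_of_ae_neg d.pos (by have := hy.1.1; fun_prop)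
    (fun a b ha hab hb => h1.mono ha.le hab hb.le) (Eventually.of_forall fun t ht => by
      have h3 : 0 ≤ (M - h t) * (max (y t) 0) ^ (1 / p) :=
        mul_nonneg (by linarith [(abs_le.1 (hM t (Ioo_subset_Icc_self ht))).2])
          (Real.rpow_nonneg (le_max_right _ _) _)
      have h4 : 0 < (M - h t) * (max (y t) 0) ^ (1 / p) - f t := by linarith [d.neg t ht]
      have := mul_pos d.conj_pos h4
      simp only [odeRhs]; linarith)
  rw [hy.2] at h2
  linarith

/-- The end value of the solution is strictly increasing in `c` where it is positive. -/
lemma sol_end_lt {c₁ c₂ : ℝ} (hc : c₁ < c₂) {y₁ y₂ : ℝ → ℝ} (h₁ : IsHalfSol p p' s h f c₁ y₁)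
    (h₂ : IsHalfSol p p' s h f c₂ y₂) (hpos : 0 < y₁ s) : y₁ s < y₂ s := by
  have hss : s ∈ Icc 0 s := right_mem_Icc.2 d.pos.le
  refine (d.sol_mono hc.le h₁ h₂ hss).lt_of_ne fun heq => ?_
  obtain ⟨M, hM0, hM⟩ := d.exists_abs_sub_le c₁
  have hp : 0 < 1 / p := one_div_pos.2 d.p_pos
  have hlim : ∀ {c y}, IsHalfSol p p' s h f c y →
      Tendsto (fun t => (max (y t) 0) ^ (1 / p)) (𝓝[<] s) (𝓝 ((max (y s) 0) ^ (1 / p))) := by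
    intro c y hy
    have h1 : ContinuousOn (fun t => (max (y t) 0) ^ (1 / p)) (Icc 0 s) :=
      (hy.1.1.sup continuousOn_const).rpow_const fun _ _ => Or.inr hp.le
    exact (h1 s hss).mono_left (nhdsWithin_le_of_mem (Icc_mem_nhdsLT d.pos))
  have hA : 0 < (max (y₁ s) 0) ^ (1 / p) :=
    Real.rpow_pos_of_pos (lt_max_of_lt_left hpos) _
  have hl : Tendsto (fun t => (c₂ - c₁) * (max (y₂ t) 0) ^ (1 / p) -
      M * |(max (y₂ t) 0) ^ (1 / p) - (max (y₁ t) 0) ^ (1 / p)|) (𝓝[<] s)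
      (𝓝 ((c₂ - c₁) * (max (y₁ s) 0) ^ (1 / p))) := by
    have := ((hlim h₂).const_mul (c₂ - c₁)).sub (((hlim h₂).sub (hlim h₁)).abs.const_mul M)
    simpa only [← heq, sub_self, abs_zero, mul_zero, sub_zero] using this
  have hev := (hl.eventually_const_lt (mul_pos (sub_pos.2 hc) hA)).and (Ioo_mem_nhdsLT d.pos)
  obtain ⟨r, hr, hrs⟩ := (mem_nhdsLT_iff_exists_Ioo_subset' d.pos).1 hev
  obtain ⟨t, ht1, ht2⟩ := exists_between (max_lt d.pos hr)
  have ht0 : 0 < t := (le_max_left _ _).trans_lt ht1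
  have hrt : r < t := (le_max_right _ _).trans_lt ht1
  have hd := (d.hasACDeriv h₁).sub (d.hasACDeriv h₂)
  have hlt := HasACDeriv.lt_of_ae_neg ht2
    ((h₁.1.1.sub h₂.1.1).mono (Icc_subset_Icc_left ht0.le))
    (fun a b ha hab hb => hd.mono (ht0.trans ha).le hab hb.le) (Eventually.of_forall fun x hx => by
      have h3 : 0 < (c₂ - c₁) * (max (y₂ x) 0) ^ (1 / p) -
        M * |(max (y₂ x) 0) ^ (1 / p) - (max (y₁ x) 0) ^ (1 / p)| :=
        (hrs ⟨hrt.trans hx.1, hx.2⟩).1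
      have h4 := hM x ⟨(ht0.trans hx.1).le, hx.2.le⟩
      have h5 : -(M * |(max (y₂ x) 0) ^ (1 / p) - (max (y₁ x) 0) ^ (1 / p)|) ≤
          (c₁ - h x) * ((max (y₂ x) 0) ^ (1 / p) - (max (y₁ x) 0) ^ (1 / p)) := by
        have h6 := neg_abs_le
          ((c₁ - h x) * ((max (y₂ x) 0) ^ (1 / p) - (max (y₁ x) 0) ^ (1 / p)))
        rw [abs_mul] at h6
        have := mul_le_mul_of_nonneg_right h4
          (abs_nonneg ((max (y₂ x) 0) ^ (1 / p) - (max (y₁ x) 0) ^ (1 / p)))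
        linarith
      have h7 : 0 < ((c₂ - h x) * (max (y₂ x) 0) ^ (1 / p) - f x) -
          ((c₁ - h x) * (max (y₁ x) 0) ^ (1 / p) - f x) := by linarith
      have := mul_pos d.conj_pos h7
      simp only [odeRhs]; linarith)
  have hlt' : y₁ s - y₂ s < y₁ t - y₂ t := hlt
  have := d.sol_mono hc.le h₁ h₂ (t := t) ⟨ht0.le, ht2.le⟩
  linarith

end HalfData

namespace IsCaraSol

variable {p p' c a b : ℝ} {h f y : ℝ → ℝ}

lemma sub_eq (hy : IsCaraSol p p' h f c a b y)
    (hF : IntervalIntegrable (odeRhs p p' h f c y) volume a b) {r t : ℝ} (hr : r ∈ Icc a b)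
    (ht : t ∈ Icc a b) : y t - y r = ∫ u in r..t, odeRhs p p' h f c y u := by
  have hab : a ≤ b := hr.1.trans hr.2
  have hi : ∀ x ∈ Icc a b, IntervalIntegrable (odeRhs p p' h f c y) volume a x := fun x hx =>
    hF.mono_set (uIcc_subset_uIcc_left (by rwa [uIcc_of_le hab]))
  rw [hy.2 t ht, hy.2 r hr, add_sub_add_left_eq_sub]
  exact integral_interval_sub_left (hi t ht) (hi r hr)

lemma mono (hy : IsCaraSol p p' h f c a b y)
    (hF : IntervalIntegrable (odeRhs p p' h f c y) volume a b) {r t : ℝ} (har : a ≤ r)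
    (htb : t ≤ b) : IsCaraSol p p' h f c r t y := by
  refine ⟨hy.1.mono (Icc_subset_Icc har htb), fun x hx => ?_⟩
  have := hy.sub_eq hF (r := r) (t := x) ⟨har, hx.1.trans (hx.2.trans htb)⟩
    ⟨har.trans hx.1, hx.2.trans htb⟩
  simp only [odeRhs] at this
  linarith

lemma reflect (hy : IsCaraSol p p' h f c a b y)
    (hF : IntervalIntegrable (odeRhs p p' h f c y) volume a b) :
    IsCaraSol p p' (fun t => -h (1 - t)) (fun t => -f (1 - t)) (-c) (1 - b) (1 - a)
      (fun t => y (1 - t)) := by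
  refine ⟨hy.1.comp (by fun_prop) fun t ht => ⟨by linarith [ht.2], by linarith [ht.1]⟩,
    fun t ht => ?_⟩
  have hb : b ∈ Icc a b := ⟨by linarith [ht.1, ht.2], le_rfl⟩
  have h1 := hy.sub_eq hF (r := 1 - t) (t := b) ⟨by linarith [ht.2], by linarith [ht.1]⟩ hb
  have h2 : ∫ u in (1 - b)..t, p' * ((-c - -h (1 - u)) * max (y (1 - u)) 0 ^ (1 / p) -
      -f (1 - u)) = ∫ u in (1 - b)..t, -odeRhs p p' h f c y (1 - u) := by
    congr 1; ext u; simp only [odeRhs]; ring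
  rw [h2, intervalIntegral.integral_neg, integral_comp_sub_left (fun u => odeRhs p p' h f c y u), sub_sub_cancel,
    ← h1]
  simp

lemma of_reflect (hy : IsCaraSol p p' (fun t => -h (1 - t)) (fun t => -f (1 - t)) (-c) a b y)
    (hF : IntervalIntegrable (odeRhs p p' (fun t => -h (1 - t)) (fun t => -f (1 - t)) (-c) y)
      volume a b) :
    IsCaraSol p p' h f c (1 - b) (1 - a) (fun t => y (1 - t)) := by
  simpa using hy.reflect hF

lemma glue {m : ℝ} {z : ℝ → ℝ} (ham : a ≤ m) (hmb : m ≤ b) (hy : IsCaraSol p p' h f c a m y)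
    (hz : IsCaraSol p p' h f c m b z) (hyz : y m = z m)
    (hF : IntervalIntegrable (odeRhs p p' h f c y) volume a m)
    (hG : IntervalIntegrable (odeRhs p p' h f c z) volume m b) :
    IsCaraSol p p' h f c a b (fun t => if t ≤ m then y t else z t) := by
  set w : ℝ → ℝ := fun t => if t ≤ m then y t else z t with hw
  have hwy : ∀ t ≤ m, w t = y t := fun t ht => if_pos ht
  have hwz : ∀ t, m ≤ t → w t = z t := fun t ht => by
    rcases ht.eq_or_lt with rfl | ht
    · rw [hwy _ le_rfl, hyz]
    · exact if_neg ht.not_ge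
  have hl : ∀ t ≤ m, odeRhs p p' h f c w t = odeRhs p p' h f c y t := fun t ht => by
    rw [odeRhs, hwy t ht, odeRhs]
  have hr : ∀ t, m ≤ t → odeRhs p p' h f c w t = odeRhs p p' h f c z t := fun t ht => by
    rw [odeRhs, hwz t ht, odeRhs]
  have il : ∀ t ∈ Icc a m, ∫ u in a..t, odeRhs p p' h f c w u =
      ∫ u in a..t, odeRhs p p' h f c y u := fun t ht =>
    integral_congr fun u hu => hl u (by rw [uIcc_of_le ht.1] at hu; exact hu.2.trans ht.2)
  have ir : ∀ t ∈ Icc m b, ∫ u in m..t, odeRhs p p' h f c w u =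
      ∫ u in m..t, odeRhs p p' h f c z u := fun t ht =>
    integral_congr fun u hu => hr u (by rw [uIcc_of_le ht.1] at hu; exact hu.1)
  have hFw : IntervalIntegrable (odeRhs p p' h f c w) volume a m := hF.congr fun u hu =>
    (hl u (by rw [uIoc_of_le ham] at hu; exact hu.2)).symm
  have hGw : IntervalIntegrable (odeRhs p p' h f c w) volume m b := hG.congr fun u hu =>
    (hr u (by rw [uIoc_of_le hmb] at hu; exact hu.1.le)).symm
  refine ⟨?_, fun t ht => ?_⟩
  · rw [← Icc_union_Icc_eq_Icc ham hmb]
    exact (hy.1.congr fun t ht => hwy t ht.2).union_of_isClosed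
      (hz.1.congr fun t ht => hwz t ht.1) isClosed_Icc isClosed_Icc
  · rcases le_total t m with htm | hmt
    · have := il t ⟨ht.1, htm⟩
      simp only [odeRhs] at this
      rw [this, hwy t htm, hwy a ham]
      exact hy.2 t ⟨ht.1, htm⟩
    · have h1 := integral_add_adjacent_intervals hFw
        (hGw.mono_set (uIcc_subset_uIcc_left (by rw [uIcc_of_le hmb]; exact ⟨hmt, ht.2⟩)) :
          IntervalIntegrable _ _ m t)
      rw [il m ⟨ham, le_rfl⟩, ir t ⟨hmt, ht.2⟩] at h1
      have h2 := hy.2 m ⟨ham, le_rfl⟩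
      have h3 := hz.2 t ⟨hmt, ht.2⟩
      simp only [odeRhs] at h1
      rw [hwz t hmt, hwy a ham]
      linarith

end IsCaraSol

/-- Solutions on two halves, with opposite parameters, can be matched at their end points. -/
lemma HalfData.exists_matching {p p' s₁ s₂ : ℝ} {h₁ f₁ h₂ f₂ : ℝ → ℝ}
    (d₁ : HalfData p p' s₁ h₁ f₁) (d₂ : HalfData p p' s₂ h₂ f₂) :
    ∃ c y₁ y₂, IsHalfSol p p' s₁ h₁ f₁ c y₁ ∧ IsHalfSol p p' s₂ h₂ f₂ (-c) y₂ ∧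
      y₁ s₁ = y₂ s₂ := by
  choose Y₁ hY₁ using d₁.exists_sol
  choose Y₂ hY₂ using d₂.exists_sol
  have hq : 0 < 1 / p' := one_div_pos.2 d₁.conj_pos
  have hs₁ : s₁ ∈ Icc 0 s₁ := right_mem_Icc.2 d₁.pos.le
  have hs₂ : s₂ ∈ Icc 0 s₂ := right_mem_Icc.2 d₂.pos.le
  have n₁ := fun c => d₁.nonneg (hY₁ c) s₁ hs₁
  have n₂ := fun c => d₂.nonneg (hY₂ c) s₂ hs₂
  have hcont : ∀ {s : ℝ} {h f : ℝ → ℝ} {Y : ℝ → ℝ → ℝ}, HalfData p p' s h f →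
      (∀ c, IsHalfSol p p' s h f c (Y c)) → Continuous fun c => Y c s ^ (1 / p') := by
    intro s h f Y d hY
    have hlip : ∀ c₁ c₂, Y c₁ s ^ (1 / p') - Y c₂ s ^ (1 / p') ≤ s * |c₁ - c₂| := by
      intro c₁ c₂
      have h1 := d.rpow_sub_rpow_le (hY c₂) (hY c₁) (right_mem_Icc.2 d.pos.le)
      have h2 : max (c₁ - c₂) 0 ≤ |c₁ - c₂| := max_le (le_abs_self _) (abs_nonneg _)
      nlinarith [d.pos]
    refine (LipschitzWith.of_dist_le_mul (K := s.toNNReal) fun c₁ c₂ => ?_).continuous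
    rw [Real.coe_toNNReal s d.pos.le, Real.dist_eq, Real.dist_eq]
    refine abs_sub_le_iff.2 ⟨hlip c₁ c₂, ?_⟩
    rw [abs_sub_comm c₁]
    exact hlip c₂ c₁
  have hE : Continuous fun c => Y₁ c s₁ ^ (1 / p') - Y₂ (-c) s₂ ^ (1 / p') :=
    (hcont d₁ hY₁).sub ((hcont d₂ hY₂).comp continuous_neg)
  obtain ⟨b, hb⟩ : ∃ b, 0 ≤ Y₁ b s₁ ^ (1 / p') - Y₂ (-b) s₂ ^ (1 / p') := by
    obtain ⟨c₁, hc₁⟩ := d₁.exists_sol_end_pos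
    obtain ⟨c₂, hc₂⟩ := d₂.exists_sol_end_lt (hc₁ _ (hY₁ c₁))
    refine ⟨max c₁ (-c₂), sub_nonneg.2 (Real.rpow_le_rpow (n₂ _) ?_ hq.le)⟩
    exact ((hc₂ _ (by linarith [le_max_right c₁ (-c₂)]) _ (hY₂ _)).trans_le
      (d₁.sol_mono (le_max_left _ _) (hY₁ _) (hY₁ _) hs₁)).le
  obtain ⟨a, ha⟩ : ∃ a, Y₁ a s₁ ^ (1 / p') - Y₂ (-a) s₂ ^ (1 / p') ≤ 0 := by
    obtain ⟨c₂, hc₂⟩ := d₂.exists_sol_end_pos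
    obtain ⟨c₁, hc₁⟩ := d₁.exists_sol_end_lt (hc₂ _ (hY₂ c₂))
    refine ⟨min c₁ (-c₂), sub_nonpos.2 (Real.rpow_le_rpow (n₁ _) ?_ hq.le)⟩
    exact ((hc₁ _ (min_le_left _ _) _ (hY₁ _)).trans_le
      (d₂.sol_mono (by linarith [min_le_right c₁ (-c₂)]) (hY₂ _) (hY₂ _) hs₂)).le
  obtain ⟨c, hc⟩ := mem_range_of_exists_le_of_exists_ge hE ⟨a, ha⟩ ⟨b, hb⟩
  exact ⟨c, Y₁ c, Y₂ (-c), hY₁ c, hY₂ (-c),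
    (Real.rpow_left_inj (n₁ _) (n₂ _) hq.ne').1 (sub_eq_zero.1 hc)⟩

lemma le_zero_of_forall_integral_neg {g : ℝ → ℝ} {a s : ℝ} (has : a < s) (hg : ContinuousAt g s)
    (h : ∀ t ∈ Ico a s, ∫ τ in t..s, g τ < 0) : g s ≤ 0 := by
  by_contra! hpos
  obtain ⟨l, hl, hls⟩ := exists_Ioc_subset_of_mem_nhds (hg.eventually_const_lt hpos) ⟨a, has⟩
  obtain ⟨t, ht, hts⟩ := exists_between (max_lt has hl)
  refine (h t ⟨(le_max_left _ _).trans ht.le, hts⟩).not_ge (integral_nonneg hts.le fun x hx => ?_)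
  exact (hls ⟨((le_max_right _ _).trans_lt ht).trans_le hx.1, hx.2⟩ : 0 < g x).le

/-- The supremum of `-f t / (s - t) ^ (p' - 1)` is positive and controls `-f`. -/
lemma HalfData.sSup_spec {p p' s : ℝ} {h f : ℝ → ℝ} (d : HalfData p p' s h f)
    (hbdd : BddAbove {x : ℝ | ∃ t ∈ Ioo (0 : ℝ) s, x = -f t / (s - t) ^ (p' - 1)}) :
    0 < sSup {x : ℝ | ∃ t ∈ Ioo (0 : ℝ) s, x = -f t / (s - t) ^ (p' - 1)} ∧
    ∀ t ∈ Ioo (0 : ℝ) s, -f t ≤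
      sSup {x : ℝ | ∃ t ∈ Ioo (0 : ℝ) s, x = -f t / (s - t) ^ (p' - 1)} * (s - t) ^ (p' - 1) := by
  have hpow : ∀ t ∈ Ioo (0 : ℝ) s, 0 < (s - t) ^ (p' - 1) := fun t ht =>
    Real.rpow_pos_of_pos (sub_pos.2 ht.2) _
  have hle : ∀ t ∈ Ioo (0 : ℝ) s, -f t / (s - t) ^ (p' - 1) ≤
      sSup {x : ℝ | ∃ t ∈ Ioo (0 : ℝ) s, x = -f t / (s - t) ^ (p' - 1)} := fun t ht =>
    le_csSup hbdd ⟨t, ht, rfl⟩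
  obtain ⟨t, ht⟩ := exists_between d.pos
  exact ⟨(div_pos (neg_pos.2 (d.neg t ht)) (hpow t ht)).trans_le (hle t ht),
    fun t ht => (div_le_iff₀ (hpow t ht)).1 (hle t ht)⟩

theorem stmt_15
    (p p' s : ℝ) (h f : ℝ → ℝ)
    (hp : 1 < p) (hp'def : p' = p / (p - 1))
    (hs : s ∈ Set.Ioo (0:ℝ) 1)
    (hmeas : Measurable h)
    (hbd : ∃ M : ℝ, ∀ t ∈ Set.Icc (0:ℝ) 1, |h t| ≤ M)
    (hfint : MeasureTheory.IntegrableOn f (Set.Ioo (0:ℝ) 1))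
    (hf0 : f 0 = 0) (hfs : f s = 0) (hf1 : f 1 = 0)
    (hfneg : ∀ t ∈ Set.Ioo (0:ℝ) s, f t < 0)
    (hfpos : ∀ t ∈ Set.Ioo s (1:ℝ), 0 < f t)
    (husc : UpperSemicontinuousOn f (Set.Ioo (0:ℝ) s))
    (hlsc : LowerSemicontinuousOn f (Set.Ioo s (1:ℝ)))
    (hhc : ContinuousAt h s)
    (hhfin : ∃ S : Finset ℝ, ContinuousOn h (Set.Icc (0:ℝ) 1 \ ↑S))
    (hint : 0 ≤ ∫ t in (0:ℝ)..1, f t)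
    (hcond : ∃ tstar ∈ Set.Icc (0:ℝ) 1, tstar ≠ s ∧ (∫ t in s..tstar, (h s - h t)) ≤ 0) :
    ∃ cstar : ℝ,
      (∀ c : ℝ, (∃ y, IsPosBVPSol p p' h f c 0 1 y) ↔ c = cstar) ∧
      (∀ y₁ y₂, IsPosBVPSol p p' h f cstar 0 1 y₁ → IsPosBVPSol p p' h f cstar 0 1 y₂ →
        Set.EqOn y₁ y₂ (Set.Icc 0 1)) ∧
      (BddAbove {x : ℝ | ∃ t ∈ Set.Ioo (0:ℝ) s, x = -f t / (s - t) ^ (p' - 1)} →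
        sInf (h '' Set.Icc (0:ℝ) s) -
          p' ^ (1 / p') * p ^ (1 / p) *
            (sSup {x : ℝ | ∃ t ∈ Set.Ioo (0:ℝ) s, x = -f t / (s - t) ^ (p' - 1)}) ^ (1 / p')
          < cstar) ∧
      (BddAbove {x : ℝ | ∃ t ∈ Set.Ioo s (1:ℝ), x = f t / (t - s) ^ (p' - 1)} →
        cstar <
          sSup (h '' Set.Icc s (1:ℝ)) +
            p' ^ (1 / p') * p ^ (1 / p) *
              (sSup {x : ℝ | ∃ t ∈ Set.Ioo s (1:ℝ), x = f t / (t - s) ^ (p' - 1)}) ^ (1 / p')) := by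
  obtain ⟨hs0, hs1⟩ := hs
  obtain ⟨M, hM⟩ := hbd
  have hp0 : 0 < p := one_pos.trans hp
  have hf : IntervalIntegrable f volume 0 1 :=
    (intervalIntegrable_iff_integrableOn_Ioo_of_le zero_le_one).2 hfint
  have hfl : IntervalIntegrable f volume 0 s :=
    hf.mono_set (uIcc_subset_uIcc_left (by rw [uIcc_of_le zero_le_one]; exact ⟨hs0.le, hs1.le⟩))
  have hfr : IntervalIntegrable f volume s 1 :=
    hf.mono_set (uIcc_subset_uIcc_right (by rw [uIcc_of_le zero_le_one]; exact ⟨hs0.le, hs1.le⟩))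
  have dl : HalfData p p' s h f := ⟨hp, hp'def, hs0, hmeas,
    ⟨M, fun t ht => hM t ⟨ht.1, ht.2.trans hs1.le⟩⟩, hfl, hfneg, husc⟩
  have dr : HalfData p p' (1 - s) (fun t => -h (1 - t)) (fun t => -f (1 - t)) := by
    refine ⟨hp, hp'def, by linarith, (hmeas.comp (measurable_const.sub measurable_id)).neg,
      ⟨M, fun t ht => ?_⟩, ?_, fun t ht => ?_, fun x hx z hz => ?_⟩
    · rw [abs_neg]
      exact hM _ ⟨by linarith [ht.2], by linarith [ht.1]⟩
    · have : IntervalIntegrable (fun t => -f (1 - t)) volume (1 - s) (1 - 1) :=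
        (hfr.comp_sub_left 1).neg
      simpa using this.symm
    · exact neg_neg_of_pos (hfpos _ ⟨by linarith [ht.2], by linarith [ht.1]⟩)
    · have hx' : 1 - x ∈ Ioo s 1 := ⟨by linarith [hx.2], by linarith [hx.1]⟩
      have ht : Tendsto (fun t : ℝ => 1 - t) (𝓝[Ioo 0 (1 - s)] x) (𝓝[Ioo s 1] (1 - x)) :=
        ContinuousWithinAt.tendsto_nhdsWithin (by fun_prop)
          fun t ht => ⟨by linarith [ht.2], by linarith [ht.1]⟩
      filter_upwards [ht.eventually (hlsc _ hx' (-z) (by linarith))] with t ht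
      linarith
  have hrhs : ∀ {c y}, ContinuousOn y (Icc 0 1) →
      IntervalIntegrable (odeRhs p p' h f c y) volume 0 1 := fun hy =>
    intervalIntegrable_odeRhs hp0 zero_le_one hmeas ⟨M, hM⟩ hf hy
  have toLeft : ∀ {c y}, IsPosBVPSol p p' h f c 0 1 y → IsHalfSol p p' s h f c y :=
    fun hy => ⟨hy.1.mono (hrhs hy.1.1) le_rfl hs1.le, hy.2.1⟩
  have toRight : ∀ {c y}, IsPosBVPSol p p' h f c 0 1 y →
      IsHalfSol p p' (1 - s) (fun t => -h (1 - t)) (fun t => -f (1 - t)) (-c)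
        (fun t => y (1 - t)) := fun {c y} hy => by
    have hF := hrhs (c := c) hy.1.1
    have h1 := (hy.1.mono hF hs0.le le_rfl).reflect
      (hF.mono_set (uIcc_subset_uIcc_right (by rw [uIcc_of_le zero_le_one]; exact ⟨hs0.le, hs1.le⟩)))
    refine ⟨by simpa using h1, by simpa using hy.2.2.1⟩
  obtain ⟨c, y, z, hy, hz, hyz⟩ := dl.exists_matching dr
  have hys : 0 < y s := by
    refine (dl.nonneg hy s ⟨hs0.le, le_rfl⟩).lt_of_ne fun h0 => ?_
    have hl : ∀ t ∈ Ico 0 s, ∫ τ in t..s, (c - h τ) < 0 := fun t ht =>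
      dl.integral_neg_of_sol_end_eq_zero hy h0.symm ht.1 ht.2
    have hr : ∀ t ∈ Ico 0 (1 - s), ∫ τ in t..(1 - s), (-c - -h (1 - τ)) < 0 := fun t ht =>
      dr.integral_neg_of_sol_end_eq_zero hz (hyz.symm.trans h0.symm) ht.1 ht.2
    have hcl : c - h s ≤ 0 := le_zero_of_forall_integral_neg (g := fun τ => c - h τ) hs0
      (continuousAt_const.sub hhc) hl
    have hcr : -c - -h (1 - (1 - s)) ≤ 0 := le_zero_of_forall_integral_neg
      (g := fun τ => -c - -h (1 - τ)) (sub_pos.2 hs1)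
      (continuousAt_const.sub (ContinuousAt.neg (ContinuousAt.comp' (g := h) (by simpa using hhc)
        (by fun_prop)))) hr
    rw [sub_sub_cancel] at hcr
    obtain rfl : c = h s := by linarith
    obtain ⟨t, ht, hts, hle⟩ := hcond
    rcases lt_or_gt_of_ne hts with hlt | hlt
    · have := hl t ⟨ht.1, hlt⟩
      rw [integral_symm] at hle
      linarith
    · have := hr (1 - t) ⟨by linarith [ht.2], by linarith⟩
      have e : ∫ τ in (1 - t)..(1 - s), (-h s - -h (1 - τ)) =
          ∫ τ in (1 - t)..(1 - s), -(fun τ => h s - h τ) (1 - τ) := by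
        congr 1; ext τ; ring
      rw [e, intervalIntegral.integral_neg, integral_comp_sub_left (fun τ => h s - h τ),
        sub_sub_cancel, sub_sub_cancel] at this
      linarith
  have hsol : IsPosBVPSol p p' h f c 0 1 (fun t => if t ≤ s then y t else z (1 - t)) := by
    have hz' := hz.1.of_reflect (dr.intervalIntegrable_odeRhs _ hz.1.1)
    simp only [sub_sub_cancel, sub_zero] at hz'
    refine ⟨hy.1.glue hs0.le hs1.le hz' hyz (dl.intervalIntegrable_odeRhs _ hy.1.1)
      (intervalIntegrable_odeRhs hp0 hs1.le hmeas
        ⟨M, fun t ht => hM t ⟨hs0.le.trans ht.1, ht.2⟩⟩ hfr hz'.1), ?_, ?_, fun t ht => ?_⟩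
    · exact (if_pos hs0.le).trans hy.2
    · simp [hs1.not_ge, hz.2]
    · beta_reduce
      split_ifs with hts
      · rcases hts.eq_or_lt with rfl | hts
        exacts [hys, dl.sol_pos hy t ⟨ht.1, hts⟩]
      · exact dr.sol_pos hz _ ⟨by linarith [ht.2], by linarith⟩
  have hpos : ∀ {c y}, IsPosBVPSol p p' h f c 0 1 y → 0 < y s := fun hy => hy.2.2.2 s ⟨hs0, hs1⟩
  have hnlt : ∀ {c₁ c₂ y₁ y₂}, IsPosBVPSol p p' h f c₁ 0 1 y₁ →
      IsPosBVPSol p p' h f c₂ 0 1 y₂ → ¬c₁ < c₂ := by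
    intro c₁ c₂ y₁ y₂ h₁ h₂ hlt
    have hl := dl.sol_end_lt hlt (toLeft h₁) (toLeft h₂) (hpos h₁)
    have hr := dr.sol_mono (neg_le_neg hlt.le) (toRight h₂) (toRight h₁)
      (right_mem_Icc.2 dr.pos.le)
    rw [sub_sub_cancel] at hr
    exact hl.not_ge hr
  refine ⟨c, fun c' => ⟨fun ⟨y', hy'⟩ => ?_, ?_⟩, fun y₁ y₂ h₁ h₂ t ht => ?_, fun hb => ?_,
    fun hb => ?_⟩
  · exact le_antisymm (not_lt.1 (hnlt hsol hy')) (not_lt.1 (hnlt hy' hsol))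
  · rintro rfl
    exact ⟨_, hsol⟩
  · rcases le_total t s with hts | hst
    · exact dl.sol_unique (toLeft h₁) (toLeft h₂) ⟨ht.1, hts⟩
    · simpa using dr.sol_unique (toRight h₁) (toRight h₂) (x := 1 - t)
        ⟨by linarith [ht.2], by linarith⟩
  · obtain ⟨hμ0, hμ⟩ := dl.sSup_spec hb
    by_contra! hle
    refine (dl.sol_end_nonpos hy (fun t ht => csInf_le ⟨-M, ?_⟩ (mem_image_of_mem h ht)) hμ hμ0
      hle).not_gt hys
    rintro _ ⟨x, hx, rfl⟩
    exact (abs_le.1 (hM x ⟨hx.1, hx.2.trans hs1.le⟩)).1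
  · have hset : {x : ℝ | ∃ t ∈ Ioo (0 : ℝ) (1 - s), x = - -f (1 - t) / (1 - s - t) ^ (p' - 1)} =
        {x : ℝ | ∃ t ∈ Ioo s (1 : ℝ), x = f t / (t - s) ^ (p' - 1)} := by
      ext x
      constructor
      · rintro ⟨t, ht, rfl⟩
        exact ⟨1 - t, ⟨by linarith [ht.2], by linarith [ht.1]⟩, by rw [neg_neg, sub_right_comm]⟩
      · rintro ⟨t, ht, rfl⟩
        refine ⟨1 - t, ⟨by linarith [ht.2], by linarith [ht.1]⟩, ?_⟩
        rw [neg_neg, sub_sub_cancel, sub_sub_sub_cancel_left]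
    rw [← hset] at hb ⊢
    obtain ⟨hμ0, hμ⟩ := dr.sSup_spec hb
    by_contra! hle
    refine (dr.sol_end_nonpos (H := -sSup (h '' Icc s 1)) hz (fun t ht => neg_le_neg
      (le_csSup ⟨M, ?_⟩ (mem_image_of_mem h ⟨by linarith [ht.2], by linarith [ht.1]⟩))) hμ hμ0
      (by linarith)).not_gt (hyz ▸ hys)
    rintro _ ⟨x, hx, rfl⟩
    exact (abs_le.1 (hM x ⟨hs0.le.trans hx.1, hx.2⟩)).2
end
end

section
/- Assume (H3) and ∫₀¹ f(t) dt ≥ 0. Suppose further that: ∫_{s_*}^{t} (h(s_*) − h(τ)) dτ > 0 for every t ∈ [0,1] with t ≠ s_*; f(t) < (1/(p' p^{p'/p})) (h(s_*) − h(t)) [∫_{s_*}^{t} (h(s_*) − h(τ)) dτ]^{p'/p} for all t ∈ (s_*, 1); and f(t) > (1/(p' p^{p'/p})) (h(s_*) − h(t)) [∫_{s_*}^{t} (h(s_*) − h(τ)) dτ]^{p'/p} for all t ∈ (0, s_*). Then for every c ∈ ℝ the boundary value problem on [0, 1] admits no positive solution. -/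
open MeasureTheory Set Filter Topology intervalIntegral

noncomputable section

/-- On `0 < w ≤ y`, the concave power `q ≤ 1` has slope at most `w ^ (q - 1)`. -/
lemma rpow_sub_rpow_le_rpow_sub_one_mul {q w y : ℝ} (hq1 : q ≤ 1) (hw : 0 < w)
    (hwy : w ≤ y) : y ^ q - w ^ q ≤ w ^ (q - 1) * (y - w) := by
  have hr : (y / w) ^ q ≤ y / w := by
    simpa using Real.rpow_le_rpow_of_exponent_le ((one_le_div hw).2 hwy) hq1
  rw [Real.div_rpow (hw.le.trans hwy) hw.le, div_le_iff₀ (Real.rpow_pos_of_pos hw q)] at hr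
  have hsplit : w ^ q = w ^ (q - 1) * w := by
    rw [Real.rpow_sub_one hw.ne', div_mul_cancel₀ _ hw.ne']
  have : y / w * w ^ q = w ^ (q - 1) * y := by
    rw [hsplit]; field_simp
  rw [this] at hr
  linarith

/-- A continuous function starting positive whose increments, up to any first zero `t₁`, are
locally bounded below by `-L` times the length of the interval times an upper bound, stays
positive. -/
lemma pos_right_of_local_sub_ge {z : ℝ → ℝ} {a b : ℝ} (hab : a ≤ b)
    (hz : ContinuousOn z (Icc a b)) (hza : 0 < z a)
    (hloc : ∀ t₁ ∈ Ioc a b, (∀ t ∈ Icc a t₁, 0 ≤ z t) → ∃ t₀ ∈ Ico a t₁, ∃ L > 0,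
      ∀ m, ∀ r ∈ Icc t₀ t₁, (∀ t ∈ Icc r t₁, z t ≤ m) → -(L * m * (t₁ - r)) ≤ z t₁ - z r) :
    0 < z b := by
  by_contra! hzb
  have hcl : IsCompact (Icc a b ∩ z ⁻¹' Iic 0) :=
    isCompact_Icc.of_isClosed_subset (hz.preimage_isClosed_of_isClosed isClosed_Icc isClosed_Iic)
      inter_subset_left
  obtain ⟨t₁, ⟨ht₁, hzt₁⟩, hmin⟩ := hcl.exists_isLeast ⟨b, ⟨hab, le_rfl⟩, hzb⟩
  simp only [mem_preimage, mem_Iic] at hzt₁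
  have hat : a < t₁ := lt_of_le_of_ne ht₁.1 (by rintro rfl; linarith)
  have hpos : ∀ t ∈ Ico a t₁, 0 < z t := fun t ht => by
    by_contra! hcon
    exact absurd (hmin ⟨⟨ht.1, ht.2.le.trans ht₁.2⟩, hcon⟩) (not_le.2 ht.2)
  have hnonneg : ∀ t ∈ Icc a t₁, 0 ≤ z t := by
    intro t ht
    have hcl' : t ∈ closure (Ico a t₁) := by rwa [closure_Ico hat.ne]
    exact continuousWithinAt_const.closure_le hcl'
      ((hz t ⟨ht.1, ht.2.trans ht₁.2⟩).mono
        (Ico_subset_Icc_self.trans (Icc_subset_Icc_right ht₁.2)))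
      fun u hu => (hpos u hu).le
  obtain ⟨t₀, ht₀, L, hL, hinc⟩ := hloc t₁ ⟨hat, ht₁.2⟩ hnonneg
  set r := max t₀ (t₁ - 1 / (2 * L)) with hr
  have hL2 : 0 < 1 / (2 * L) := by positivity
  have hrt : r < t₁ := max_lt ht₀.2 (by linarith)
  have hsub : Icc r t₁ ⊆ Icc a b :=
    Icc_subset_Icc (ht₀.1.trans (le_max_left _ _)) ht₁.2
  obtain ⟨u, hu, humax⟩ := isCompact_Icc.exists_isMaxOn (nonempty_Icc.2 hrt.le) (hz.mono hsub)
  have hzu : 0 < z u :=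
    (hpos r ⟨ht₀.1.trans (le_max_left _ _), hrt⟩).trans_le (humax ⟨le_rfl, hrt.le⟩)
  have hineq := hinc (z u) u ⟨(le_max_left _ _).trans hu.1, hu.2⟩
    (fun t ht => humax ⟨hu.1.trans ht.1, ht.2⟩)
  have hlen : L * (t₁ - u) ≤ 1 / 2 := by
    have : t₁ - u ≤ 1 / (2 * L) := by linarith [(le_max_right t₀ (t₁ - 1 / (2 * L))).trans hu.1]
    calc L * (t₁ - u) ≤ L * (1 / (2 * L)) := by gcongr
      _ = 1 / 2 := by field_simp
  nlinarith

/-- Forward comparison of `y` with the barrier `((∫ (k - h)) / p) ^ p'`: a solution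
with speed `c ≥ k` which is positive at the left endpoint is positive at the right endpoint. -/
lemma caraSol_right_pos {p p' k c a b : ℝ} {h f y : ℝ → ℝ} {S : Set ℝ}
    (hp : 1 < p) (hp' : p' = p / (p - 1)) (hab : a < b) (hS : S.Countable)
    (hhm : Measurable h) (hhb : ∃ M, ∀ t ∈ Icc a b, |h t| ≤ M)
    (hhc : ∀ t ∈ Ioo a b \ S, ContinuousAt h t)
    (hf : IntervalIntegrable f volume a b) (hkc : k ≤ c)
    (hy : ContinuousOn y (Icc a b)) (hya : 0 < y a)
    (hyeq : ∀ r ∈ Icc a b, ∀ t ∈ Icc a b,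
      y t - y r = ∫ u in r..t, p' * ((c - h u) * (max (y u) 0) ^ (1 / p) - f u))
    (hH : ∀ t ∈ Ioc a b, 0 < ∫ τ in a..t, (k - h τ))
    (hfH : ∀ t ∈ Ioo a b,
      f t < 1 / (p' * p ^ (p' / p)) * (k - h t) * (∫ τ in a..t, (k - h τ)) ^ (p' / p)) :
    0 < y b := by
  have hp0 : 0 < p := by linarith
  have hp1 : 0 < p - 1 := by linarith
  have hp'0 : 0 < p' := by rw [hp']; positivity
  have hconj : p' / p = p' - 1 := by rw [hp']; field_simp; ring
  have hconj' : p' * (1 / p) = p' - 1 := by rw [← hconj]; ring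
  have hp'1 : 1 ≤ p' := by rw [hp', le_div_iff₀ hp1]; linarith
  obtain ⟨M, hM⟩ := hhb
  have hkint : ∀ r ∈ Icc a b, ∀ t ∈ Icc a b,
      IntervalIntegrable (fun τ => k - h τ) volume r t := by
    intro r hr t ht
    refine intervalIntegrable_const.sub ?_
    rw [intervalIntegrable_iff]
    refine Measure.integrableOn_of_bounded (M := M) (by simp) hhm.aestronglyMeasurable ?_
    refine (ae_restrict_iff' measurableSet_uIoc).2 (ae_of_all _ fun u hu => hM u ?_)
    have hu' := uIoc_subset_uIcc hu
    exact (uIcc_subset_Icc hr ht) hu'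
  set H : ℝ → ℝ := fun t => ∫ τ in a..t, (k - h τ) with hHdef
  have haI : a ∈ Icc a b := ⟨le_rfl, hab.le⟩
  have hbI : b ∈ Icc a b := ⟨hab.le, le_rfl⟩
  have hHcont : ContinuousOn H (Icc a b) := by
    have := intervalIntegral.continuousOn_primitive_interval' (hkint a haI b hbI)
      (left_mem_uIcc (a := a) (b := b))
    rwa [uIcc_of_le hab.le] at this
  have hHnn : ∀ t ∈ Icc a b, 0 ≤ H t := by
    intro t ht
    rcases eq_or_lt_of_le ht.1 with rfl | hlt
    · simp [hHdef]
    · exact (hH t ⟨hlt, ht.2⟩).le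
  have hHderiv : ∀ t ∈ Ioo a b \ S, HasDerivAt H (k - h t) t := by
    intro t ht
    refine intervalIntegral.integral_hasDerivAt_right
      (hkint a haI t ⟨ht.1.1.le, ht.1.2.le⟩) ?_ (continuousAt_const.sub (hhc t ht))
    exact (measurable_const.sub hhm).stronglyMeasurable.stronglyMeasurableAtFilter
  set W : ℝ → ℝ := fun t => (H t / p) ^ p' with hWdef
  have hWcont : ContinuousOn W (Icc a b) :=
    (hHcont.div_const p).rpow_const fun _ _ => Or.inr hp'0.le
  have hWpos : ∀ t ∈ Ioc a b, 0 < W t := fun t ht =>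
    Real.rpow_pos_of_pos (div_pos (hH t ht) hp0) _
  set W' : ℝ → ℝ := fun t => (k - h t) / p * p' * (H t / p) ^ (p' - 1) with hW'def
  have hWderiv : ∀ t ∈ Ioo a b \ S, HasDerivAt W (W' t) t := by
    intro t ht
    exact ((hHderiv t ht).div_const p).rpow_const (Or.inr hp'1)
  have hW'int : ∀ r ∈ Icc a b, ∀ t ∈ Icc a b, IntervalIntegrable W' volume r t := by
    intro r hr t ht
    refine (((hkint r hr t ht).div_const p).mul_const p').mul_continuousOn ?_
    exact ((hHcont.mono (uIcc_subset_Icc hr ht)).div_const p).rpow_const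
      fun _ _ => Or.inr (by linarith)
  have hWeq : ∀ r ∈ Icc a b, ∀ t ∈ Icc a b, r ≤ t → W t - W r = ∫ u in r..t, W' u := by
    intro r hr t ht hrt
    refine (MeasureTheory.integral_eq_of_hasDerivAt_off_countable W W' hS
      (hWcont.mono (uIcc_subset_Icc hr ht)) (fun u hu => hWderiv u ⟨?_, hu.2⟩)
      (hW'int r hr t ht)).symm
    rw [min_eq_left hrt, max_eq_right hrt] at hu
    exact ⟨hr.1.trans_lt hu.1.1, hu.1.2.trans_le ht.2⟩
  have hYint : ∀ r ∈ Icc a b, ∀ t ∈ Icc a b, IntervalIntegrable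
      (fun u => p' * ((c - h u) * (max (y u) 0) ^ (1 / p) - f u)) volume r t := by
    intro r hr t ht
    have hsub : uIcc r t ⊆ uIcc a b := by
      rw [uIcc_of_le hab.le]; exact uIcc_subset_Icc hr ht
    refine IntervalIntegrable.const_mul (IntervalIntegrable.sub ?_ (hf.mono_set hsub)) p'
    have hc : IntervalIntegrable (fun u => c - h u) volume r t := by
      have := (hkint r hr t ht).add (intervalIntegrable_const (c := c - k))
      refine this.congr fun u _ => ?_
      ring
    refine hc.mul_continuousOn ?_
    exact ((hy.mono (uIcc_subset_Icc hr ht)).sup continuousOn_const).rpow_const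
      fun _ _ => Or.inr (by positivity)
  have hz : 0 < y b - W b := by
    refine pos_right_of_local_sub_ge (z := fun t => y t - W t) hab.le (hy.sub hWcont) ?_ ?_
    · have : W a = 0 := by simp [hWdef, hHdef, Real.zero_rpow hp'0.ne']
      simpa [this] using hya
    intro t₁ ht₁ hnn
    have hmid : a < (a + t₁) / 2 := by linarith [ht₁.1]
    have hmid' : (a + t₁) / 2 < t₁ := by linarith [ht₁.1]
    have hsubI : Icc ((a + t₁) / 2) t₁ ⊆ Icc a b := Icc_subset_Icc hmid.le ht₁.2
    obtain ⟨K, hK⟩ : ∃ K, ∀ t ∈ Icc ((a + t₁) / 2) t₁, W t ^ (1 / p - 1) ≤ K := by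
      have hcont : ContinuousOn (fun t => W t ^ (1 / p - 1)) (Icc ((a + t₁) / 2) t₁) :=
        (hWcont.mono hsubI).rpow_const fun t ht =>
          Or.inl (hWpos t ⟨hmid.trans_le ht.1, ht.2.trans ht₁.2⟩).ne'
      obtain ⟨K, hK⟩ := isCompact_Icc.bddAbove_image hcont
      exact ⟨K, fun t ht => hK ⟨t, ht, rfl⟩⟩
    have hB0 : 0 ≤ |k| + M := add_nonneg (abs_nonneg _) ((abs_nonneg _).trans (hM a haI))
    set L := p' * (|k| + M) * |K| + 1 with hLdef
    have hL1 : 0 ≤ p' * (|k| + M) * |K| := by positivity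
    refine ⟨(a + t₁) / 2, ⟨hmid.le, hmid'⟩, L, by linarith, ?_⟩
    intro m r hr hm
    have hrI := hsubI hr
    have ht₁I : t₁ ∈ Icc a b := ⟨ht₁.1.le, ht₁.2⟩
    have hdiff : (y t₁ - W t₁) - (y r - W r) =
        ∫ u in r..t₁, (p' * ((c - h u) * (max (y u) 0) ^ (1 / p) - f u) - W' u) := by
      rw [intervalIntegral.integral_sub (hYint r hrI t₁ ht₁I) (hW'int r hrI t₁ ht₁I),
        ← hyeq r hrI t₁ ht₁I, ← hWeq r hrI t₁ ht₁I hr.2]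
      ring
    have hconst : ∫ _ in r..t₁, -(L * m) = -(L * m * (t₁ - r)) := by
      rw [intervalIntegral.integral_const, smul_eq_mul]; ring
    rw [hdiff, ← hconst]
    refine intervalIntegral.integral_mono_on_of_le_Ioo hr.2 intervalIntegrable_const
      ((hYint r hrI t₁ ht₁I).sub (hW'int r hrI t₁ ht₁I)) fun u hu => ?_
    have huK : u ∈ Icc ((a + t₁) / 2) t₁ := ⟨hr.1.trans hu.1.le, hu.2.le⟩
    have hau : a < u := hmid.trans_le huK.1
    have hub : u < b := hu.2.trans_le ht₁.2
    have hWu := hWpos u ⟨hau, hub.le⟩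
    have hzu : 0 ≤ y u - W u := hnn u ⟨hau.le, hu.2.le⟩
    have hzm : y u - W u ≤ m := hm u ⟨hu.1.le, hu.2.le⟩
    have hHu : 0 < H u := hH u ⟨hau, hub.le⟩
    have hfu := hfH u ⟨hau, hub⟩
    rw [max_eq_left (by linarith)]
    set Q := (H u / p) ^ (p' - 1) with hQ
    have hWQ : W u ^ (1 / p) = Q := by
      rw [hWdef, hQ, ← Real.rpow_mul (by positivity), hconj']
    have hfQ : p' * f u ≤ (k - h u) * Q := by
      have : 1 / (p' * p ^ (p' / p)) * (k - h u) * (H u) ^ (p' / p) = (k - h u) * Q / p' := by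
        rw [hQ, Real.div_rpow hHu.le hp0.le, hconj]; field_simp
      rw [hHdef] at this
      rw [this, lt_div_iff₀ hp'0] at hfu
      linarith
    have hW'u : W' u = (k - h u) * Q * (p' - 1) := by
      rw [← hconj]; simp only [hW'def, ← hQ]; ring
    have hslope : y u ^ (1 / p) - Q ≤ |K| * (y u - W u) := by
      rw [← hWQ]
      refine (rpow_sub_rpow_le_rpow_sub_one_mul ?_ hWu (by linarith)).trans ?_
      · rw [div_le_one hp0]; exact hp.le
      · exact mul_le_mul_of_nonneg_right ((hK u huK).trans (le_abs_self K)) hzu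
    have hmono : 0 ≤ y u ^ (1 / p) - Q := by
      rw [← hWQ, sub_nonneg]
      exact Real.rpow_le_rpow hWu.le (by linarith) (by positivity)
    have hkh : -(|k| + M) ≤ k - h u := by
      have h1 := neg_abs_le k
      have h2 := le_of_abs_le (hM u ⟨hau.le, hub.le⟩)
      linarith
    have hyq : 0 ≤ y u ^ (1 / p) := Real.rpow_nonneg (by linarith) _
    have hstep₁ : p' * ((k - h u) * (y u ^ (1 / p) - Q)) ≤
        p' * ((c - h u) * y u ^ (1 / p) - f u) - W' u := by
      rw [hW'u]
      have := mul_nonneg (mul_nonneg hp'0.le (sub_nonneg.2 hkc)) hyq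
      linarith
    have hstep₂ : -((|k| + M) * (|K| * (y u - W u))) ≤ (k - h u) * (y u ^ (1 / p) - Q) := by
      have h1 := mul_le_mul_of_nonneg_right hkh hmono
      have h2 := mul_le_mul_of_nonneg_left hslope hB0
      linarith
    have hstep₃ := mul_le_mul_of_nonneg_left hstep₂ hp'0.le
    have hstep₄ := mul_le_mul_of_nonneg_left hzm hL1
    have hLm : L * m = p' * (|k| + M) * |K| * m + m := by rw [hLdef]; ring
    linarith
  linarith [hWpos b ⟨hab, le_rfl⟩]

theorem stmt_16
    (p p' s : ℝ) (h f : ℝ → ℝ)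
    (hp : 1 < p) (hp'def : p' = p / (p - 1))
    (hs : s ∈ Set.Ioo (0:ℝ) 1)
    (hmeas : Measurable h)
    (hbd : ∃ M : ℝ, ∀ t ∈ Set.Icc (0:ℝ) 1, |h t| ≤ M)
    (hfint : MeasureTheory.IntegrableOn f (Set.Ioo (0:ℝ) 1))
    (hf0 : f 0 = 0) (hfs : f s = 0) (hf1 : f 1 = 0)
    (hfneg : ∀ t ∈ Set.Ioo (0:ℝ) s, f t < 0)
    (hfpos : ∀ t ∈ Set.Ioo s (1:ℝ), 0 < f t)
    (husc : UpperSemicontinuousOn f (Set.Ioo (0:ℝ) s))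
    (hlsc : LowerSemicontinuousOn f (Set.Ioo s (1:ℝ)))
    (hhc : ContinuousAt h s)
    (hhfin : ∃ S : Finset ℝ, ContinuousOn h (Set.Icc (0:ℝ) 1 \ ↑S))
    (hint : 0 ≤ ∫ t in (0:ℝ)..1, f t)
    (h1 : ∀ t ∈ Set.Icc (0:ℝ) 1, t ≠ s → 0 < ∫ τ in s..t, (h s - h τ))
    (h2 : ∀ t ∈ Set.Ioo s (1:ℝ),
      f t < 1 / (p' * p ^ (p' / p)) * (h s - h t) * (∫ τ in s..t, (h s - h τ)) ^ (p' / p))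
    (h3 : ∀ t ∈ Set.Ioo (0:ℝ) s,
      1 / (p' * p ^ (p' / p)) * (h s - h t) * (∫ τ in s..t, (h s - h τ)) ^ (p' / p) < f t) :
    ∀ c : ℝ, ¬ ∃ y, IsPosBVPSol p p' h f c 0 1 y := by
  rintro c ⟨y, ⟨hycont, hysol⟩, hy0, hy1, hypos⟩
  obtain ⟨S, hS⟩ := hhfin
  obtain ⟨M, hM⟩ := hbd
  have hys := hypos s hs
  have hhc' : ∀ t ∈ Ioo (0 : ℝ) 1, t ∉ S → ContinuousAt h t := by
    intro t ht htS
    refine hS.continuousAt (inter_mem (Icc_mem_nhds ht.1 ht.2) ?_)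
    exact S.finite_toSet.isClosed.isOpen_compl.mem_nhds (by simpa using htS)
  have hf01 : IntervalIntegrable f volume 0 1 := by
    rwa [intervalIntegrable_iff_integrableOn_Ioo_of_le zero_le_one]
  have hint01 : IntervalIntegrable
      (fun u => p' * ((c - h u) * (max (y u) 0) ^ (1 / p) - f u)) volume 0 1 := by
    refine IntervalIntegrable.const_mul (IntervalIntegrable.sub ?_ hf01) p'
    have hc : IntervalIntegrable (fun u => c - h u) volume 0 1 := by
      refine intervalIntegrable_const.sub ?_
      rw [intervalIntegrable_iff_integrableOn_Icc_of_le zero_le_one]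
      refine Measure.integrableOn_of_bounded (M := M) (by simp) hmeas.aestronglyMeasurable ?_
      exact (ae_restrict_iff' measurableSet_Icc).2 (ae_of_all _ fun u hu => hM u hu)
    refine hc.mul_continuousOn ?_
    rw [uIcc_of_le zero_le_one]
    exact (hycont.sup continuousOn_const).rpow_const fun _ _ => Or.inr (by positivity)
  have hyeq : ∀ r ∈ Icc (0 : ℝ) 1, ∀ t ∈ Icc (0 : ℝ) 1,
      y t - y r = ∫ u in r..t, p' * ((c - h u) * (max (y u) 0) ^ (1 / p) - f u) := by
    intro r hr t ht
    have hsub : ∀ v ∈ Icc (0 : ℝ) 1, uIcc 0 v ⊆ uIcc (0 : ℝ) 1 := fun v hv => by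
      rw [uIcc_of_le zero_le_one]
      exact uIcc_subset_Icc ⟨le_rfl, zero_le_one⟩ hv
    rw [hysol t ht, hysol r hr, ← intervalIntegral.integral_interval_sub_left
      (hint01.mono_set (hsub t ht)) (hint01.mono_set (hsub r hr))]
    ring
  rcases le_total (h s) c with hc | hc
  · have hsub : Icc s 1 ⊆ Icc (0 : ℝ) 1 := Icc_subset_Icc_left hs.1.le
    refine (caraSol_right_pos (S := S) (k := h s) hp hp'def hs.2 S.countable_toSet hmeas
      ⟨M, fun t ht => hM t (hsub ht)⟩ (fun t ht => hhc' t ⟨hs.1.trans ht.1.1, ht.1.2⟩ ht.2)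
      (hf01.mono_set ?_) hc (hycont.mono hsub) hys
      (fun r hr t ht => hyeq r (hsub hr) t (hsub ht))
      (fun t ht => h1 t (hsub ⟨ht.1.le, ht.2⟩) ht.1.ne') h2).ne' hy1
    rwa [uIcc_of_le zero_le_one, uIcc_of_le hs.2.le]
  · have hneg : ∀ t ∈ Icc (-s) 0, -t ∈ Icc (0 : ℝ) 1 := fun t ht =>
      ⟨by linarith [ht.2], by linarith [ht.1, hs.2]⟩
    have hrefl : ∀ t, ∫ τ in (-s)..t, (-h s - -h (-τ)) = ∫ τ in s..(-t), (h s - h τ) := by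
      intro t
      rw [intervalIntegral.integral_comp_neg (fun τ => -h s - -h τ), neg_neg,
        intervalIntegral.integral_symm, ← intervalIntegral.integral_neg]
      congr 1
      funext τ
      ring
    have hpos := caraSol_right_pos (S := Neg.neg ⁻¹' (S : Set ℝ)) (a := -s) (b := 0) (k := -h s)
      (c := -c) (h := fun t => -h (-t)) (f := fun t => -f (-t)) (y := fun t => y (-t)) hp hp'def
      (by linarith [hs.1]) (S.countable_toSet.preimage neg_injective) (by fun_prop)
      ⟨M, fun t ht => by simpa using hM (-t) (hneg t ht)⟩ ?_ ?_ (by linarith)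
      (hycont.comp continuousOn_neg hneg) (by simpa using hys) ?_ ?_ ?_
    · simp [hy0] at hpos
    · intro t ht
      exact (ContinuousAt.comp (f := fun t : ℝ => -t) (g := h) (hhc' (-t)
        ⟨by linarith [ht.1.2], by linarith [ht.1.1, hs.2]⟩ ht.2) continuousAt_neg).neg
    · have hfs' : IntervalIntegrable f volume s 0 := hf01.mono_set (by
        rw [uIcc_of_ge hs.1.le, uIcc_of_le zero_le_one]
        exact Icc_subset_Icc_right hs.2.le)
      rw [IntervalIntegrable.iff_comp_neg] at hfs'
      rw [← neg_zero]
      exact hfs'.neg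
    · intro r hr t ht
      rw [hyeq (-r) (hneg r hr) (-t) (hneg t ht), intervalIntegral.integral_symm,
        ← intervalIntegral.integral_comp_neg, ← intervalIntegral.integral_neg]
      congr 1
      funext u
      ring
    · intro t ht
      rw [hrefl]
      exact h1 (-t) (hneg t ⟨ht.1.le, ht.2⟩) (by linarith [ht.1])
    · intro t ht
      rw [hrefl]
      have := h3 (-t) ⟨by linarith [ht.2], by linarith [ht.1]⟩
      linarith
end
end

section
/- Assume 0 < μ̃ < ∞, where μ̃ = sup_{t ∈ (0, s_*)} (−f(t))/(s_* − t)^{p'−1}, and set h_m = inf_{t ∈ [0, s_*]} h(t). If c ≤ h_m − (p')^{1/p'} p^{1/p} μ̃^{1/p'}, then every Carathéodory solution y on [0, s_*] of the ODE with y(0) = 0 satisfies 0 ≤ y(t) ≤ ((h_m − c)/p)^{p'} (s_* − t)^{p'} for all t ∈ [0, s_*]; in particular y(s_*) = 0, and the boundary value problem on [0, s_*] admits a positive solution. -/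
open MeasureTheory Set Filter Topology intervalIntegral

noncomputable section

/-- A primitive starting at a nonpositive value whose density is at most `M` wherever the
primitive is positive stays below `M * t`. -/
theorem le_mul_of_density_le_where_pos {s M : ℝ} {z k : ℝ → ℝ} (hM : 0 ≤ M)
    (hz : ContinuousOn z (Icc 0 s)) (hk : IntervalIntegrable k volume 0 s) (h0 : z 0 ≤ 0)
    (hzk : ∀ t ∈ Icc 0 s, z t = z 0 + ∫ u in 0..t, k u)
    (hle : ∀ u ∈ Ioo 0 s, 0 < z u → k u ≤ M) : ∀ t ∈ Icc 0 s, z t ≤ M * t := by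
  intro t ht
  by_contra! hlt
  set S : Set ℝ := Icc 0 t ∩ z ⁻¹' Iic 0 with hS
  have hts : Icc 0 t ⊆ Icc 0 s := Icc_subset_Icc_right ht.2
  have hSc : IsClosed S := (hz.mono hts).preimage_isClosed_of_isClosed isClosed_Icc isClosed_Iic
  have hSb : BddAbove S := ⟨t, fun x hx => hx.1.2⟩
  have hmem : sSup S ∈ S := hSc.csSup_mem ⟨0, ⟨le_rfl, ht.1⟩, h0⟩ hSb
  set r := sSup S with hr
  have hr0 : 0 ≤ r := hmem.1.1
  have hrt : r ≤ t := hmem.1.2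
  have hzr : z r ≤ 0 := hmem.2
  have hpos : ∀ u ∈ Ioo r t, 0 < z u := by
    intro u hu
    by_contra! hzu
    exact absurd (le_csSup hSb (show u ∈ S from ⟨⟨hr0.trans hu.1.le, hu.2.le⟩, hzu⟩))
      (not_le.2 hu.1)
  have hs0 : 0 ≤ s := ht.1.trans ht.2
  have hsub : ∀ x ∈ Icc 0 s, ∀ y ∈ Icc 0 s, IntervalIntegrable k volume x y := by
    intro x hx y hy
    refine hk.mono_set ?_
    rw [uIcc_of_le hs0]
    exact uIcc_subset_Icc hx hy
  have h0m : (0 : ℝ) ∈ Icc 0 s := ⟨le_rfl, hs0⟩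
  have hrm : r ∈ Icc 0 s := ⟨hr0, hrt.trans ht.2⟩
  have hadd := intervalIntegral.integral_add_adjacent_intervals
    (hsub 0 h0m r hrm) (hsub r hrm t ht)
  have hint : ∫ u in r..t, k u ≤ ∫ _ in r..t, M :=
    intervalIntegral.integral_mono_on_of_le_Ioo hrt (hsub r hrm t ht) (by simp) fun u hu =>
      hle u ⟨hr0.trans_lt hu.1, hu.2.trans_le ht.2⟩ (hpos u hu)
  simp only [intervalIntegral.integral_const, smul_eq_mul] at hint
  have h1 := hzk t ht
  have h2 := hzk r hrm
  nlinarith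

/-- Carathéodory existence for a Lipschitz nonlinearity with separated coefficients. -/
theorem exists_solution_of_lipschitz {s C : ℝ} {L : NNReal} {a b φ : ℝ → ℝ} (hs : 0 ≤ s)
    (ha : IntervalIntegrable a volume 0 s) (haC : ∀ u ∈ Icc 0 s, |a u| ≤ C)
    (hb : IntervalIntegrable b volume 0 s) (hφ : LipschitzWith L φ) :
    ∃ y : C(Icc (0 : ℝ) s, ℝ), ∀ t : Icc (0 : ℝ) s,
      y t = ∫ u in 0..(t : ℝ), (a u * φ (IccExtend hs y u) + b u) := by
  have hC : 0 ≤ C := (abs_nonneg _).trans (haC 0 ⟨le_rfl, hs⟩)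
  set K : ℝ := C * L with hK
  have hK0 : 0 ≤ K := by positivity
  set l : ℝ := 2 * (K + 1) with hl
  have hl0 : 0 < l := by positivity
  have hcont : ∀ z : C(Icc (0 : ℝ) s, ℝ), Continuous (IccExtend hs z) :=
    fun z => z.continuous.Icc_extend'
  have hint : ∀ z : C(Icc (0 : ℝ) s, ℝ), IntervalIntegrable
      (fun u => a u * φ (Real.exp (l * u) * IccExtend hs z u) + b u) volume 0 s := by
    intro z
    refine (ha.mul_continuousOn (Continuous.continuousOn ?_)).add hb
    have := hcont z
    exact hφ.continuous.comp (by fun_prop)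
  have hsub : ∀ {k : ℝ → ℝ}, IntervalIntegrable k volume 0 s → ∀ t : Icc (0 : ℝ) s,
      IntervalIntegrable k volume 0 t := by
    intro k hk t
    refine hk.mono_set ?_
    rw [uIcc_of_le hs, uIcc_of_le t.2.1]
    exact Icc_subset_Icc_right t.2.2
  let T : C(Icc (0 : ℝ) s, ℝ) → C(Icc (0 : ℝ) s, ℝ) := fun z =>
    ⟨fun t => Real.exp (-(l * t)) *
      ∫ u in 0..(t : ℝ), (a u * φ (Real.exp (l * u) * IccExtend hs z u) + b u), by
      have h1 := intervalIntegral.continuousOn_primitive_interval' (hint z) left_mem_uIcc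
      rw [uIcc_of_le hs] at h1
      have h2 := continuousOn_iff_continuous_domRestrict.1 h1
      exact Continuous.mul (by fun_prop) h2⟩
  have hT : ContractingWith (1 / 2) T := by
    refine ⟨by norm_num, LipschitzWith.of_dist_le_mul fun z w => ?_⟩
    refine (ContinuousMap.dist_le (by positivity)).2 fun t => ?_
    have hd : ∀ u ∈ Ioc (0 : ℝ) t,
        ‖(a u * φ (Real.exp (l * u) * IccExtend hs z u) + b u) -
          (a u * φ (Real.exp (l * u) * IccExtend hs w u) + b u)‖ ≤
        K * dist z w * Real.exp (l * u) := by
      intro u hu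
      have hus : u ∈ Icc (0 : ℝ) s := ⟨hu.1.le, hu.2.trans t.2.2⟩
      have e1 := hφ.dist_le_mul (Real.exp (l * u) * IccExtend hs z u)
        (Real.exp (l * u) * IccExtend hs w u)
      have e2 : dist (IccExtend hs z u) (IccExtend hs w u) ≤ dist z w :=
        ContinuousMap.dist_apply_le_dist _
      rw [Real.dist_eq] at e1 e2
      rw [Real.dist_eq, ← mul_sub, abs_mul, abs_of_pos (Real.exp_pos _)] at e1
      rw [Real.norm_eq_abs, add_sub_add_right_eq_sub, ← mul_sub, abs_mul]
      calc _ ≤ C * (L * (Real.exp (l * u) * dist z w)) := by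
            gcongr
            · exact haC u hus
            · exact e1.trans (by gcongr)
        _ = _ := by rw [hK]; ring
    have hexp : ∫ u in (0 : ℝ)..t, K * dist z w * Real.exp (l * u) =
        K * dist z w * ((Real.exp (l * t) - 1) / l) := by
      rw [intervalIntegral.integral_const_mul, intervalIntegral.integral_comp_mul_left _ hl0.ne']
      simp [div_eq_inv_mul]
    have hI := intervalIntegral.norm_integral_le_of_norm_le (μ := volume) t.2.1
      (Eventually.of_forall hd) (Continuous.intervalIntegrable (by fun_prop) _ _)
    rw [intervalIntegral.integral_sub (hsub (hint z) t) (hsub (hint w) t), hexp] at hI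
    change dist (Real.exp (-(l * t)) * _) (Real.exp (-(l * t)) * _) ≤ _
    rw [Real.dist_eq, ← mul_sub, abs_mul, abs_of_pos (Real.exp_pos _)]
    have hdz : 0 ≤ dist z w := dist_nonneg
    calc _ ≤ Real.exp (-(l * t)) * (K * dist z w * ((Real.exp (l * t) - 1) / l)) := by
          gcongr; exact hI
      _ ≤ Real.exp (-(l * t)) * (K * dist z w * (Real.exp (l * t) / l)) := by
          gcongr; linarith
      _ = K / l * dist z w * (Real.exp (-(l * t)) * Real.exp (l * t)) := by ring
      _ = K / l * dist z w := by rw [← Real.exp_add]; simp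
      _ ≤ _ := by
          gcongr
          rw [div_le_iff₀ hl0, hl]
          push_cast
          linarith
  let x : C(Icc (0 : ℝ) s, ℝ) := ContractingWith.fixedPoint T hT
  have hx : T x = x := hT.fixedPoint_isFixedPt
  refine ⟨⟨fun t => Real.exp (l * t) * x t, by fun_prop⟩, fun t => ?_⟩
  have hxt : x t = Real.exp (-(l * t)) *
      ∫ u in 0..(t : ℝ), (a u * φ (Real.exp (l * u) * IccExtend hs x u) + b u) :=
    (DFunLike.congr_fun hx t).symm
  change Real.exp (l * t) * x t = _
  rw [hxt, ← mul_assoc, ← Real.exp_add, add_neg_cancel, Real.exp_zero, one_mul]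
  refine intervalIntegral.integral_congr fun u hu => ?_
  rw [uIcc_of_le t.2.1] at hu
  have hus : u ∈ Icc (0 : ℝ) s := ⟨hu.1, hu.2.trans t.2.2⟩
  simp [IccExtend_of_mem hs _ hus]

/-- Carathéodory existence for a nonpositive coefficient and a monotone nonlinearity that is a
uniform limit of Lipschitz functions. -/
theorem exists_solution_of_monotone {s C : ℝ} {L : ℕ → NNReal} {a b φ : ℝ → ℝ}
    {ψ : ℕ → ℝ → ℝ} {δ : ℕ → ℝ} (hs : 0 ≤ s)
    (ha : IntervalIntegrable a volume 0 s) (haC : ∀ u ∈ Icc 0 s, |a u| ≤ C)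
    (ha0 : ∀ u ∈ Icc 0 s, a u ≤ 0) (hb : IntervalIntegrable b volume 0 s)
    (hφ : Monotone φ) (hφc : Continuous φ) (hψ : ∀ n, LipschitzWith (L n) (ψ n))
    (hδ : Tendsto δ atTop (𝓝 0)) (hψφ : ∀ n x, |ψ n x - φ x| ≤ δ n) :
    ∃ y : ℝ → ℝ, Continuous y ∧ ∀ t ∈ Icc 0 s, y t = ∫ u in 0..t, (a u * φ (y u) + b u) := by
  have hC : 0 ≤ C := (abs_nonneg _).trans (haC 0 ⟨le_rfl, hs⟩)
  have hδ0 : ∀ n, 0 ≤ δ n := fun n => (abs_nonneg _).trans (hψφ n 0)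
  choose y hy using fun n => exists_solution_of_lipschitz hs ha haC hb (hψ n)
  let Y : ℕ → ℝ → ℝ := fun n => IccExtend hs (y n)
  have hYc : ∀ n, Continuous (Y n) := fun n => (y n).continuous.Icc_extend'
  have hYy : ∀ n (t : Icc (0 : ℝ) s), Y n t = y n t := fun n t => IccExtend_val hs _ t
  have hY : ∀ n, ∀ t ∈ Icc 0 s, Y n t = ∫ u in 0..t, (a u * ψ n (Y n u) + b u) :=
    fun n t ht => (hYy n ⟨t, ht⟩).trans (hy n ⟨t, ht⟩)
  have hint : ∀ n, IntervalIntegrable (fun u => a u * ψ n (Y n u) + b u) volume 0 s := fun n =>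
    (ha.mul_continuousOn ((hψ n).continuous.comp (hYc n)).continuousOn).add hb
  have hsub : ∀ {k : ℝ → ℝ}, IntervalIntegrable k volume 0 s → ∀ t ∈ Icc 0 s,
      IntervalIntegrable k volume 0 t := by
    intro k hk t ht
    refine hk.mono_set ?_
    rw [uIcc_of_le hs, uIcc_of_le ht.1]
    exact Icc_subset_Icc_right ht.2
  have hY0 : ∀ n, Y n 0 = 0 := fun n => by rw [hY n 0 ⟨le_rfl, hs⟩]; simp
  have hdiff : ∀ n m, ∀ t ∈ Icc 0 s, Y n t - Y m t ≤ C * (δ n + δ m) * s := by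
    intro n m t ht
    have hnm := le_mul_of_density_le_where_pos
      (z := fun t => Y n t - Y m t) (M := C * (δ n + δ m))
      (k := fun u => (a u * ψ n (Y n u) + b u) - (a u * ψ m (Y m u) + b u))
      (mul_nonneg hC (add_nonneg (hδ0 n) (hδ0 m)))
      ((hYc n).sub (hYc m)).continuousOn ((hint n).sub (hint m)) (by simp [hY0])
      (fun t ht => by
        rw [intervalIntegral.integral_sub (hsub (hint n) t ht) (hsub (hint m) t ht), hY0, hY0,
          ← hY n t ht, ← hY m t ht]
        ring)
      (fun u hu hpos => by
        have hus := Ioo_subset_Icc_self hu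
        have h1 := abs_le.1 (hψφ n (Y n u))
        have h2 := abs_le.1 (hψφ m (Y m u))
        have h3 : φ (Y m u) ≤ φ (Y n u) := hφ (sub_pos.1 hpos).le
        have h4 := ha0 u hus
        have h5 := (abs_le.1 (haC u hus)).1
        have h6 : -(δ n + δ m) ≤ ψ n (Y n u) - ψ m (Y m u) := by linarith
        have h7 := add_nonneg (hδ0 n) (hδ0 m)
        nlinarith) t ht
    exact hnm.trans (mul_le_mul_of_nonneg_left ht.2
      (mul_nonneg hC (add_nonneg (hδ0 n) (hδ0 m))))
  have hcauchy : CauchySeq y := by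
    refine Metric.cauchySeq_iff.2 fun ε hε => ?_
    have hlim : Tendsto (fun n => C * δ n * s) atTop (𝓝 0) := by
      simpa using (hδ.const_mul C).mul_const s
    obtain ⟨N, hN⟩ := eventually_atTop.1 (hlim.eventually_lt_const (half_pos hε))
    refine ⟨N, fun m hm n hn => ?_⟩
    have hb : C * (δ m + δ n) * s < ε := by linarith [hN m hm, hN n hn]
    refine lt_of_le_of_lt ((ContinuousMap.dist_le ?_).2 fun t => ?_) hb
    · exact mul_nonneg (mul_nonneg hC (add_nonneg (hδ0 m) (hδ0 n))) hs
    · rw [Real.dist_eq, ← hYy, ← hYy, abs_sub_le_iff]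
      refine ⟨hdiff m n t t.2, (hdiff n m t t.2).trans_eq ?_⟩
      ring
  obtain ⟨x, hx⟩ := cauchySeq_tendsto_of_complete hcauchy
  let X : ℝ → ℝ := IccExtend hs x
  have hXc : Continuous X := x.continuous.Icc_extend'
  have hYX : ∀ n u, |Y n u - X u| ≤ dist (y n) x := fun n u =>
    ContinuousMap.dist_apply_le_dist (f := y n) (g := x) (projIcc 0 s hs u)
  have hdist : Tendsto (fun n => dist (y n) x) atTop (𝓝 0) := tendsto_iff_dist_tendsto_zero.1 hx
  have hYlim : ∀ u, Tendsto (fun n => Y n u) atTop (𝓝 (X u)) := fun u =>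
    tendsto_iff_dist_tendsto_zero.2
      (squeeze_zero (fun _ => dist_nonneg) (fun n => hYX n u) hdist)
  have hψlim : ∀ u, Tendsto (fun n => ψ n (Y n u)) atTop (𝓝 (φ (X u))) := by
    intro u
    have h1 : Tendsto (fun n => ψ n (Y n u) - φ (Y n u)) atTop (𝓝 0) :=
      squeeze_zero_norm (fun n => hψφ n _) hδ
    simpa using h1.add ((hφc.tendsto _).comp (hYlim u))
  obtain ⟨B, hB⟩ := (isCompact_Icc (a := -(‖x‖ + 1)) (b := ‖x‖ + 1)).exists_bound_of_continuousOn
    hφc.continuousOn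
  refine ⟨X, hXc, fun t ht => ?_⟩
  have hbound : ∀ᶠ n in atTop, ∀ u, |ψ n (Y n u)| ≤ B + 1 := by
    filter_upwards [hdist.eventually_lt_const one_pos, hδ.eventually_lt_const one_pos]
      with n h1 h2 u
    have hXu : |X u| ≤ ‖x‖ := x.norm_coe_le_norm (projIcc 0 s hs u)
    have h3 : |Y n u| ≤ ‖x‖ + 1 := by
      have := abs_add_le (Y n u - X u) (X u)
      rw [sub_add_cancel] at this
      linarith [hYX n u]
    have h4 := hB (Y n u) (abs_le.1 h3)
    rw [Real.norm_eq_abs] at h4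
    have := abs_add_le (ψ n (Y n u) - φ (Y n u)) (φ (Y n u))
    rw [sub_add_cancel] at this
    linarith [hψφ n (Y n u)]
  have hlim := intervalIntegral.tendsto_integral_filter_of_dominated_convergence
    (μ := volume) (a := 0) (b := t) (l := atTop)
    (F := fun n u => a u * ψ n (Y n u) + b u) (f := fun u => a u * φ (X u) + b u)
    (fun u => |a u| * (B + 1) + |b u|)
    (Eventually.of_forall fun n => (hsub (hint n) t ht).def'.aestronglyMeasurable)
    (hbound.mono fun n hn => Eventually.of_forall fun u _ => by
      refine (norm_add_le _ _).trans ?_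
      rw [norm_mul]
      exact add_le_add (mul_le_mul_of_nonneg_left (hn u) (abs_nonneg _)) le_rfl)
    (((hsub ha t ht).abs.mul_const _).add (hsub hb t ht).abs)
    (Eventually.of_forall fun u _ => ((hψlim u).const_mul _).add_const _)
  refine tendsto_nhds_unique (hYlim t) (hlim.congr fun n => (hY n t ht).symm)

/-- Truncating the argument of `x ^ α` below at `ε` makes it Lipschitz. -/
theorem lipschitzWith_max_rpow {α ε : ℝ} (hα0 : 0 ≤ α) (hα1 : α ≤ 1) (hε : 0 < ε) :
    LipschitzWith (ε ^ (α - 1)).toNNReal fun x : ℝ => max x ε ^ α := by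
  have key : ∀ x y : ℝ, ε ≤ y → y ≤ x → x ^ α - y ^ α ≤ ε ^ (α - 1) * (x - y) := by
    intro x y hy hxy
    have hy0 : 0 < y := hε.trans_le hy
    have hx0 : 0 < x := hy0.trans_le hxy
    have h1 : x ^ (α - 1) ≤ y ^ (α - 1) :=
      Real.rpow_le_rpow_of_nonpos hy0 hxy (by linarith)
    have h2 : y ^ (α - 1) ≤ ε ^ (α - 1) :=
      Real.rpow_le_rpow_of_nonpos hε hy (by linarith)
    have hx : x ^ α = x ^ (α - 1) * x := by
      rw [← Real.rpow_add_one hx0.ne', sub_add_cancel]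
    have hy' : y ^ α = y ^ (α - 1) * y := by
      rw [← Real.rpow_add_one hy0.ne', sub_add_cancel]
    rw [hx, hy']
    nlinarith
  refine LipschitzWith.of_le_add_mul _ fun x y => ?_
  rw [Real.coe_toNNReal _ (by positivity)]
  rcases le_total (max y ε) (max x ε) with h | h
  · have h1 := key _ _ (le_max_right y ε) h
    have h2 : max x ε - max y ε ≤ dist x y :=
      (le_abs_self _).trans (abs_max_sub_max_le_abs x y ε)
    have h3 : 0 ≤ ε ^ (α - 1) := by positivity
    nlinarith
  · have h1 : max x ε ^ α ≤ max y ε ^ α :=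
      Real.rpow_le_rpow (hε.le.trans (le_max_right _ _)) h hα0
    have h2 : 0 ≤ ε ^ (α - 1) * dist x y := by positivity
    linarith

theorem continuous_max_zero_rpow {α : ℝ} (hα : 0 ≤ α) :
    Continuous fun x : ℝ => max x 0 ^ α :=
  (continuous_id.max continuous_const).rpow_const fun _ => Or.inr hα

theorem monotone_max_zero_rpow {α : ℝ} (hα : 0 ≤ α) : Monotone fun x : ℝ => max x 0 ^ α :=
  fun _ _ hxy => Real.rpow_le_rpow (le_max_right _ _) (max_le_max_right 0 hxy) hα

theorem abs_max_rpow_sub_max_zero_rpow_le {α ε : ℝ} (hα : 0 ≤ α) (hε : 0 < ε) (x : ℝ) :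
    |max x ε ^ α - max x 0 ^ α| ≤ ε ^ α := by
  rcases le_total ε x with h | h
  · rw [max_eq_left h, max_eq_left (hε.le.trans h), sub_self, abs_zero]
    positivity
  · rw [max_eq_right h, abs_of_nonneg (sub_nonneg.2 (Real.rpow_le_rpow (le_max_right _ _)
      (max_le h hε.le) hα))]
    exact sub_le_self _ (Real.rpow_nonneg (le_max_right _ _) _)

/-- Existence for the initial value problem with zero datum when `c ≤ h`. -/
theorem exists_isCaraSol {p p' s c M : ℝ} {h f : ℝ → ℝ} (hp : 1 < p) (hp' : 0 < p')
    (hs : 0 ≤ s) (hh : IntervalIntegrable h volume 0 s) (hhM : ∀ u ∈ Icc 0 s, |h u| ≤ M)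
    (hf : IntervalIntegrable f volume 0 s) (hch : ∀ u ∈ Icc 0 s, c ≤ h u) :
    ∃ y, IsCaraSol p p' h f c 0 s y ∧ y 0 = 0 := by
  have hα0 : 0 < 1 / p := by positivity
  have hα1 : 1 / p ≤ 1 := (div_le_one (by linarith)).2 hp.le
  have hε : ∀ n : ℕ, 0 < 1 / ((n : ℝ) + 1) := fun n => Nat.one_div_pos_of_nat
  obtain ⟨y, hyc, hy⟩ := exists_solution_of_monotone
    (a := fun u => p' * (c - h u)) (b := fun u => -(p' * f u)) (C := p' * (|c| + M))
    (ψ := fun (n : ℕ) x => max x (1 / ((n : ℝ) + 1)) ^ (1 / p))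
    (δ := fun n : ℕ => (1 / ((n : ℝ) + 1)) ^ (1 / p)) hs
    ((intervalIntegrable_const.sub hh).const_mul _)
    (fun u hu => by
      rw [abs_mul, abs_of_pos hp']
      exact mul_le_mul_of_nonneg_left ((abs_sub _ _).trans (by linarith [hhM u hu])) hp'.le)
    (fun u hu => mul_nonpos_of_nonneg_of_nonpos hp'.le (by linarith [hch u hu]))
    (hf.const_mul _).neg (monotone_max_zero_rpow hα0.le) (continuous_max_zero_rpow hα0.le)
    (fun n => lipschitzWith_max_rpow hα0.le hα1 (hε n))
    (by
      have := (tendsto_one_div_add_atTop_nhds_zero_nat (𝕜 := ℝ)).rpow_const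
        (p := 1 / p) (Or.inr hα0.le)
      rwa [Real.zero_rpow hα0.ne'] at this)
    (fun n x => abs_max_rpow_sub_max_zero_rpow_le hα0.le (hε n) x)
  have hy0 : y 0 = 0 := by rw [hy 0 ⟨le_rfl, hs⟩]; simp
  refine ⟨y, ⟨hyc.continuousOn, fun t ht => ?_⟩, hy0⟩
  rw [hy0, zero_add, hy t ht]
  exact intervalIntegral.integral_congr fun u _ => by ring

namespace IsCaraSol

variable {p p' s c : ℝ} {h f y : ℝ → ℝ}

theorem intervalIntegrable (hp : 0 < p) (hs : 0 ≤ s) (hh : IntervalIntegrable h volume 0 s)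
    (hf : IntervalIntegrable f volume 0 s) (hy : IsCaraSol p p' h f c 0 s y) :
    IntervalIntegrable (fun u => p' * ((c - h u) * max (y u) 0 ^ (1 / p) - f u))
      volume 0 s := by
  refine ((IntervalIntegrable.mul_continuousOn (intervalIntegrable_const.sub hh) ?_).sub
    hf).const_mul _
  rw [uIcc_of_le hs]
  exact (continuous_max_zero_rpow (by positivity)).comp_continuousOn hy.1

theorem nonneg (hp : 0 < p) (hp' : 0 < p') (hs : 0 ≤ s) (hh : IntervalIntegrable h volume 0 s)
    (hf : IntervalIntegrable f volume 0 s) (hfneg : ∀ u ∈ Ioo 0 s, f u ≤ 0)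
    (hy : IsCaraSol p p' h f c 0 s y) (hy0 : y 0 = 0) : ∀ t ∈ Icc 0 s, 0 ≤ y t := by
  intro t ht
  have := le_mul_of_density_le_where_pos (z := fun t => -y t) le_rfl hy.1.neg
    (hy.intervalIntegrable hp hs hh hf).neg (by simp [hy0])
    (fun t ht => by
      simp only [Pi.neg_apply]
      rw [intervalIntegral.integral_neg, hy.2 t ht]; ring)
    (fun u hu hpos => by
      have h1 : max (y u) 0 = 0 := max_eq_right (by linarith)
      simp only [Pi.neg_apply]
      rw [h1, Real.zero_rpow (by positivity)]
      nlinarith [hfneg u hu]) t ht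
  linarith

/-- The explicit supersolution `B * (s - t) ^ p'` dominates every solution starting at `0`. -/
theorem le_barrier {H B μ : ℝ} (hp : 0 < p) (hp' : 1 < p') (hs : 0 ≤ s)
    (hh : IntervalIntegrable h volume 0 s) (hf : IntervalIntegrable f volume 0 s)
    (hpp : p' / p = p' - 1) (hB : 0 ≤ B) (hcH : c ≤ H) (hH : ∀ u ∈ Icc 0 s, H ≤ h u)
    (hfμ : ∀ u ∈ Ioo 0 s, -f u ≤ μ * (s - u) ^ (p' - 1))
    (hsuper : B - (H - c) * B ^ (1 / p) + μ ≤ 0)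
    (hy : IsCaraSol p p' h f c 0 s y) (hy0 : y 0 = 0) :
    ∀ t ∈ Icc 0 s, y t ≤ B * (s - t) ^ p' := by
  intro t ht
  have hder : ∀ u, HasDerivAt (fun t => B * (s - t) ^ p')
      (-(p' * B * (s - u) ^ (p' - 1))) u := by
    intro u
    have h1 : HasDerivAt (fun t => s - t) (-1) u := by
      simpa using (hasDerivAt_id u).const_sub s
    exact ((h1.rpow_const (p := p') (Or.inr hp'.le)).const_mul B).congr_deriv (by ring)
  have hdc : Continuous fun u => -(p' * B * (s - u) ^ (p' - 1)) := by
    have : Continuous fun u => (s - u) ^ (p' - 1) :=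
      (continuous_const.sub continuous_id).rpow_const fun _ => Or.inr (by linarith)
    fun_prop
  have hwc : Continuous fun t => B * (s - t) ^ p' :=
    continuous_iff_continuousAt.2 fun u => (hder u).continuousAt
  have hi := hy.intervalIntegrable hp hs hh hf
  have := le_mul_of_density_le_where_pos (z := fun t => y t - B * (s - t) ^ p') le_rfl
    (hy.1.sub hwc.continuousOn) (hi.sub (hdc.intervalIntegrable 0 s))
    (by
      have : 0 ≤ B * (s - 0) ^ p' := mul_nonneg hB (Real.rpow_nonneg (by linarith) _)
      linarith)
    (fun t ht => by
      have hi' := hi.mono_set (c := 0) (d := t) (by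
        rw [uIcc_of_le hs, uIcc_of_le ht.1]; exact Icc_subset_Icc_right ht.2)
      rw [intervalIntegral.integral_sub hi' (hdc.intervalIntegrable 0 t),
        intervalIntegral.integral_eq_sub_of_hasDerivAt (fun u _ => hder u)
          (hdc.intervalIntegrable 0 t), hy.2 t ht]
      ring)
    (fun u hu hpos => by
      have hu0 : 0 ≤ s - u := by linarith [hu.2]
      have hus := Ioo_subset_Icc_self hu
      have hw0 : 0 ≤ B * (s - u) ^ p' := mul_nonneg hB (Real.rpow_nonneg hu0 _)
      have hφ : (B * (s - u) ^ p') ^ (1 / p) ≤ max (y u) 0 ^ (1 / p) :=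
        Real.rpow_le_rpow hw0 ((sub_pos.1 hpos).le.trans (le_max_left _ _)) (by positivity)
      rw [Real.mul_rpow hB (Real.rpow_nonneg hu0 _), ← Real.rpow_mul hu0, mul_one_div, hpp]
        at hφ
      have h1 : (c - h u) * max (y u) 0 ^ (1 / p) ≤
          (c - H) * (B ^ (1 / p) * (s - u) ^ (p' - 1)) :=
        calc _ ≤ (c - H) * max (y u) 0 ^ (1 / p) := by
              gcongr
              exact hH u hus
          _ ≤ _ := mul_le_mul_of_nonpos_left hφ (by linarith)
      have h2 := hfμ u hu
      have h3 : 0 ≤ (s - u) ^ (p' - 1) := Real.rpow_nonneg hu0 _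
      have h4 := mul_nonpos_of_nonpos_of_nonneg hsuper h3
      have h5 : (c - h u) * max (y u) 0 ^ (1 / p) - f u + B * (s - u) ^ (p' - 1) ≤ 0 := by
        linarith
      have h6 := mul_nonpos_of_nonneg_of_nonpos (by linarith : (0 : ℝ) ≤ p') h5
      linarith) t ht
  linarith

/-- A nonnegative solution cannot vanish where `f` is negative and upper semicontinuous. -/
theorem pos {M : ℝ} (hp : 0 < p) (hp' : 0 < p') (hh : IntervalIntegrable h volume 0 s)
    (hhM : ∀ u ∈ Icc 0 s, |h u| ≤ M) (hf : IntervalIntegrable f volume 0 s)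
    (hfneg : ∀ u ∈ Ioo 0 s, f u < 0) (husc : UpperSemicontinuousOn f (Ioo 0 s))
    (hy : IsCaraSol p p' h f c 0 s y) (hynn : ∀ t ∈ Icc 0 s, 0 ≤ y t) :
    ∀ t ∈ Ioo 0 s, 0 < y t := by
  intro t ht
  have hs : 0 ≤ s := (ht.1.trans ht.2).le
  by_contra! hle
  have hyt : y t = 0 := le_antisymm hle (hynn t (Ioo_subset_Icc_self ht))
  have hft := hfneg t ht
  have hnhds : Ioo 0 s ∈ 𝓝 t := Ioo_mem_nhds ht.1 ht.2
  have hfev : ∀ᶠ u in 𝓝 t, f u < f t / 2 := by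
    have := husc t ht (f t / 2) (by linarith)
    rwa [nhdsWithin_eq_nhds.2 hnhds] at this
  have hyev : ∀ᶠ u in 𝓝 t, (|c| + M) * max (y u) 0 ^ (1 / p) < -f t / 2 := by
    have hc : ContinuousAt y t :=
      hy.1.continuousAt (mem_of_superset hnhds Ioo_subset_Icc_self)
    have hlim : Tendsto (fun u => (|c| + M) * max (y u) 0 ^ (1 / p)) (𝓝 t)
        (𝓝 ((|c| + M) * max (y t) 0 ^ (1 / p))) :=
      (((continuous_max_zero_rpow (by positivity : 0 ≤ 1 / p)).tendsto _).comp hc).const_mul _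
    refine hlim.eventually_lt_const ?_
    rw [hyt, max_self, Real.zero_rpow (by positivity), mul_zero]
    linarith
  obtain ⟨l, u, htlu, hlu⟩ := mem_nhds_iff_exists_Ioo_subset.1
    (inter_mem hnhds (hfev.and hyev))
  obtain ⟨r, hlr, hrt⟩ := exists_between htlu.1
  have hrlu : r ∈ Ioo l u := ⟨hlr, hrt.trans htlu.2⟩
  have hr := Ioo_subset_Icc_self (hlu hrlu).1
  have hi := hy.intervalIntegrable hp hs hh hf
  have hsub : ∀ x ∈ Icc 0 s, ∀ z ∈ Icc 0 s, IntervalIntegrable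
      (fun u => p' * ((c - h u) * max (y u) 0 ^ (1 / p) - f u)) volume x z := by
    intro x hx z hz
    refine hi.mono_set ?_
    rw [uIcc_of_le hs]
    exact uIcc_subset_Icc hx hz
  have h0 : (0 : ℝ) ∈ Icc 0 s := ⟨le_rfl, hs⟩
  have ht' := Ioo_subset_Icc_self ht
  have hadd := intervalIntegral.integral_add_adjacent_intervals
    (hsub 0 h0 r hr) (hsub r hr t ht')
  have hpos := intervalIntegral.intervalIntegral_pos_of_pos_on (hsub r hr t ht') (fun v hv => by
    obtain ⟨hv1, hv2, hv3⟩ := hlu ⟨hlr.trans hv.1, hv.2.trans htlu.2⟩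
    have h1 : -(|c| + M) ≤ c - h v := by
      linarith [neg_abs_le c, (abs_le.1 (hhM v (Ioo_subset_Icc_self hv1))).2]
    have h2 : 0 ≤ max (y v) 0 ^ (1 / p) := Real.rpow_nonneg (le_max_right _ _) _
    have h3 := mul_le_mul_of_nonneg_right h1 h2
    exact mul_pos hp' (by linarith)) hrt
  linarith [hy.2 t ht', hy.2 r hr, hynn r hr]

end IsCaraSol

/-- The smallness condition on `c` makes the barrier coefficient `(D / p) ^ p'` admissible. -/
theorem barrier_coefficient_le {p p' μ D : ℝ} (hp : 1 < p) (hp' : p' = p / (p - 1))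
    (hμ : 0 ≤ μ) (hD : p' ^ (1 / p') * p ^ (1 / p) * μ ^ (1 / p') ≤ D) (hD0 : 0 < D) :
    (D / p) ^ p' - D * ((D / p) ^ p') ^ (1 / p) + μ ≤ 0 := by
  have hp0 : 0 < p := by linarith
  have hp1 : 0 < p - 1 := by linarith
  have hp'0 : 0 < p' := by rw [hp']; positivity
  have hpp : p' / p = p' - 1 := by rw [hp']; field_simp; ring
  have hA : 0 < D / p := by positivity
  have e1 : ((D / p) ^ p') ^ (1 / p) = (D / p) ^ p' / (D / p) := by
    rw [← Real.rpow_mul hA.le, mul_one_div, hpp, Real.rpow_sub_one hA.ne']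
  have e2 : p' * p ^ (p' - 1) * μ ≤ D ^ p' := by
    have := Real.rpow_le_rpow (by positivity) hD hp'0.le
    rwa [Real.mul_rpow (by positivity) (by positivity),
      Real.mul_rpow (by positivity) (by positivity), ← Real.rpow_mul hp'0.le,
      ← Real.rpow_mul hp0.le, ← Real.rpow_mul hμ, one_div_mul_cancel hp'0.ne', Real.rpow_one,
      Real.rpow_one, one_div_mul_eq_div, hpp] at this
  rw [Real.rpow_sub_one hp0.ne'] at e2
  have e3 : μ / (p - 1) ≤ (D / p) ^ p' := by
    rw [Real.div_rpow hD0.le hp0.le, le_div_iff₀ (by positivity)]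
    refine le_trans (le_of_eq ?_) e2
    rw [hp']
    field_simp
  rw [div_le_iff₀ hp1] at e3
  rw [e1]
  have e4 : D * ((D / p) ^ p' / (D / p)) = p * (D / p) ^ p' := by field_simp
  rw [e4]
  linarith

theorem stmt_17
    (p p' s : ℝ) (h f : ℝ → ℝ)
    (hp : 1 < p) (hp'def : p' = p / (p - 1))
    (hs : s ∈ Set.Ioo (0:ℝ) 1)
    (hmeas : Measurable h)
    (hbd : ∃ M : ℝ, ∀ t ∈ Set.Icc (0:ℝ) 1, |h t| ≤ M)
    (hfint : MeasureTheory.IntegrableOn f (Set.Ioo (0:ℝ) 1))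
    (hf0 : f 0 = 0) (hfs : f s = 0) (hf1 : f 1 = 0)
    (hfneg : ∀ t ∈ Set.Ioo (0:ℝ) s, f t < 0)
    (hfpos : ∀ t ∈ Set.Ioo s (1:ℝ), 0 < f t)
    (husc : UpperSemicontinuousOn f (Set.Ioo (0:ℝ) s))
    (hlsc : LowerSemicontinuousOn f (Set.Ioo s (1:ℝ)))
    (hbddA : BddAbove {x : ℝ | ∃ t ∈ Set.Ioo (0:ℝ) s, x = -f t / (s - t) ^ (p' - 1)})
    (hposA : 0 < sSup {x : ℝ | ∃ t ∈ Set.Ioo (0:ℝ) s, x = -f t / (s - t) ^ (p' - 1)})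
    (c : ℝ)
    (hc : c ≤ sInf (h '' Set.Icc (0:ℝ) s) -
      p' ^ (1 / p') * p ^ (1 / p) *
        (sSup {x : ℝ | ∃ t ∈ Set.Ioo (0:ℝ) s, x = -f t / (s - t) ^ (p' - 1)}) ^ (1 / p')) :
    (∀ y, IsCaraSol p p' h f c 0 s y → y 0 = 0 →
      (∀ t ∈ Set.Icc (0:ℝ) s,
        0 ≤ y t ∧ y t ≤ ((sInf (h '' Set.Icc (0:ℝ) s) - c) / p) ^ p' * (s - t) ^ p') ∧
      y s = 0) ∧
    (∃ y, IsPosBVPSol p p' h f c 0 s y) := by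
  obtain ⟨M, hM⟩ := hbd
  set H := sInf (h '' Icc (0 : ℝ) s)
  set μ := sSup {x : ℝ | ∃ t ∈ Ioo (0 : ℝ) s, x = -f t / (s - t) ^ (p' - 1)}
  have hp0 : 0 < p := by linarith
  have hp1 : 0 < p - 1 := by linarith
  have hp'1 : 1 < p' := by rw [hp'def, lt_div_iff₀ hp1]; linarith
  have hp'0 : 0 < p' := by linarith
  have hpp : p' / p = p' - 1 := by rw [hp'def]; field_simp; ring
  have hs0 : 0 ≤ s := hs.1.le
  have hM' : ∀ u ∈ Icc 0 s, |h u| ≤ M := fun u hu => hM u ⟨hu.1, hu.2.trans hs.2.le⟩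
  have hhi : IntervalIntegrable h volume 0 s := by
    rw [intervalIntegrable_iff_integrableOn_Icc_of_le hs0]
    exact Measure.integrableOn_of_bounded (by simp) hmeas.aestronglyMeasurable
      (ae_restrict_of_forall_mem measurableSet_Icc hM')
  have hfi : IntervalIntegrable f volume 0 s := by
    rw [intervalIntegrable_iff_integrableOn_Ioo_of_le hs0]
    exact hfint.mono_set (Ioo_subset_Ioo_right hs.2.le)
  have hH : ∀ u ∈ Icc 0 s, H ≤ h u := fun u hu =>
    csInf_le ⟨-M, by rintro _ ⟨v, hv, rfl⟩; exact (abs_le.1 (hM' v hv)).1⟩ ⟨u, hu, rfl⟩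
  have hcond : p' ^ (1 / p') * p ^ (1 / p) * μ ^ (1 / p') ≤ H - c := by linarith
  have hD0 : 0 < H - c := lt_of_lt_of_le (by positivity) hcond
  have hfμ : ∀ u ∈ Ioo 0 s, -f u ≤ μ * (s - u) ^ (p' - 1) := fun u hu =>
    (div_le_iff₀ (Real.rpow_pos_of_pos (sub_pos.2 hu.2) _)).1 (le_csSup hbddA ⟨u, hu, rfl⟩)
  have hbound : ∀ y, IsCaraSol p p' h f c 0 s y → y 0 = 0 →
      (∀ t ∈ Icc (0 : ℝ) s, 0 ≤ y t ∧ y t ≤ ((H - c) / p) ^ p' * (s - t) ^ p') ∧ y s = 0 := by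
    intro y hy hy0
    have hnn := hy.nonneg hp0 hp'0 hs0 hhi hfi (fun u hu => (hfneg u hu).le) hy0
    have hub := hy.le_barrier hp0 hp'1 hs0 hhi hfi hpp (B := ((H - c) / p) ^ p')
      (by positivity) (by linarith) hH hfμ
      (barrier_coefficient_le hp hp'def hposA.le hcond hD0) hy0
    have hsm : s ∈ Icc 0 s := ⟨hs0, le_rfl⟩
    refine ⟨fun t ht => ⟨hnn t ht, hub t ht⟩, le_antisymm ((hub s hsm).trans_eq ?_) (hnn s hsm)⟩
    rw [sub_self, Real.zero_rpow hp'0.ne', mul_zero]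
  refine ⟨hbound, ?_⟩
  obtain ⟨y, hy, hy0⟩ := exists_isCaraSol hp hp'0 hs0 hhi hM' hfi
    (fun u hu => by linarith [hH u hu] : ∀ u ∈ Icc 0 s, c ≤ h u)
  obtain ⟨hyb, hys⟩ := hbound y hy hy0
  exact ⟨y, hy, hy0, hys, hy.pos hp0 hp'0 hhi hM' hfi hfneg husc fun t ht => (hyb t ht).1⟩
end
end

section
/- Assume in addition that h is continuous at s_* and that liminf_{t → s_*⁺} f(t)/(t − s_*)^{p'−1} = 0. Let y be a Carathéodory solution on [s_*, 1] of the ODE with parameter c = h(s_*), satisfying y(s_*) = 0 and y(t) > 0 for all t ∈ (s_*, 1). Then lim_{t → s_*⁺} y(t)^{1/p'}/(t − s_*) = 0. -/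
open MeasureTheory Set Filter Topology intervalIntegral

noncomputable section

/-- A one-sided bound on the integrand bounds the interval integral, integrable or not. -/
theorem intervalIntegral_le_of_le_const {g : ℝ → ℝ} {a b C : ℝ} (hab : a ≤ b) (hC : 0 ≤ C)
    (hg : ∀ u ∈ Set.Ioo a b, g u ≤ C) : ∫ u in a..b, g u ≤ (b - a) * C := by
  by_cases hi : IntervalIntegrable g volume a b
  · calc ∫ u in a..b, g u ≤ ∫ _ in a..b, C :=
          intervalIntegral.integral_mono_on_of_le_Ioo hab hi intervalIntegrable_const hg
      _ = (b - a) * C := by simp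
  · rw [intervalIntegral.integral_undef hi]
    exact mul_nonneg (sub_nonneg.2 hab) hC

/-- Evaluating the equation at a maximum point of `y` on `[a, t]` bounds `y t ^ (1 / p')` linearly. -/
theorem IsCaraSol.rpow_le_of_sub_le {p p' c a b t ε : ℝ} {h f y : ℝ → ℝ}
    (hp : 1 < p) (hpp : p' = p / (p - 1)) (hy : IsCaraSol p p' h f c a b y)
    (hya : y a = 0) (hat : a < t) (htb : t ≤ b) (hyt : 0 < y t) (hε : 0 ≤ ε)
    (hh : ∀ u ∈ Set.Ioo a t, c - h u ≤ ε) (hf : ∀ u ∈ Set.Ioo a t, 0 ≤ f u) :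
    y t ^ (1 / p') ≤ p' * ε * (t - a) := by
  have hp0 : 0 < p := by linarith
  have hp1 : 0 < p - 1 := by linarith
  have hp' : 0 < p' := hpp ▸ div_pos hp0 hp1
  have hconj : 1 / p' = 1 - 1 / p := by rw [hpp]; field_simp
  obtain ⟨τ, ⟨haτ, hτt⟩, hmax⟩ := isCompact_Icc.exists_isMaxOn (nonempty_Icc.2 hat.le)
    (hy.1.mono (Icc_subset_Icc_right htb))
  have hle : y t ≤ y τ := hmax (right_mem_Icc.2 hat.le)
  have hτ : 0 < y τ := hyt.trans_le hle
  have hbound : y τ ≤ (τ - a) * (p' * (ε * y τ ^ (1 / p))) := by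
    have heq := hy.2 τ ⟨haτ, hτt.trans htb⟩
    rw [hya, zero_add] at heq
    refine heq.trans_le (intervalIntegral_le_of_le_const haτ (by positivity) fun u hu => ?_)
    have hut : u ∈ Set.Ioo a t := ⟨hu.1, hu.2.trans_le hτt⟩
    have hyu : y u ≤ y τ := hmax ⟨hut.1.le, hut.2.le⟩
    have hfu := hf u hut
    have hpow : (max (y u) 0) ^ (1 / p) ≤ y τ ^ (1 / p) :=
      Real.rpow_le_rpow (le_max_right _ _) (max_le hyu hτ.le) (by positivity)
    have hmul := mul_le_mul (hh u hut) hpow (by positivity) hε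
    exact mul_le_mul_of_nonneg_left (by linarith) hp'.le
  have hsplit : y τ = y τ ^ (1 / p') * y τ ^ (1 / p) := by
    rw [← Real.rpow_add hτ, hconj, sub_add_cancel, Real.rpow_one]
  have hτle : y τ ^ (1 / p') ≤ p' * ε * (τ - a) := by
    refine le_of_mul_le_mul_right ?_ (Real.rpow_pos_of_pos hτ (1 / p))
    rw [← hsplit]
    linarith
  calc y t ^ (1 / p') ≤ y τ ^ (1 / p') := Real.rpow_le_rpow hyt.le hle (by positivity)
    _ ≤ p' * ε * (τ - a) := hτle
    _ ≤ p' * ε * (t - a) := by gcongr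

theorem stmt_18
    (p p' s : ℝ) (h f : ℝ → ℝ)
    (hp : 1 < p) (hp'def : p' = p / (p - 1))
    (hs : s ∈ Set.Ioo (0:ℝ) 1)
    (hmeas : Measurable h)
    (hbd : ∃ M : ℝ, ∀ t ∈ Set.Icc (0:ℝ) 1, |h t| ≤ M)
    (hfint : MeasureTheory.IntegrableOn f (Set.Ioo (0:ℝ) 1))
    (hf0 : f 0 = 0) (hfs : f s = 0) (hf1 : f 1 = 0)
    (hfneg : ∀ t ∈ Set.Ioo (0:ℝ) s, f t < 0)
    (hfpos : ∀ t ∈ Set.Ioo s (1:ℝ), 0 < f t)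
    (husc : UpperSemicontinuousOn f (Set.Ioo (0:ℝ) s))
    (hlsc : LowerSemicontinuousOn f (Set.Ioo s (1:ℝ)))
    (hhc : ContinuousAt h s)
    (hliminf : Filter.liminf (fun t => ((f t / (t - s) ^ (p' - 1) : ℝ) : EReal)) (𝓝[>] s) = 0)
    (y : ℝ → ℝ)
    (hy : IsCaraSol p p' h f (h s) s 1 y)
    (hy0 : y s = 0)
    (hypos : ∀ t ∈ Set.Ioo s (1:ℝ), 0 < y t) :
    Filter.Tendsto (fun t => (y t) ^ (1 / p') / (t - s)) (𝓝[>] s) (𝓝 0) := by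
  have hp' : 0 < p' := hp'def ▸ div_pos (by linarith) (by linarith)
  rw [Metric.tendsto_nhds]
  intro η hη
  have hε : 0 < η / (2 * p') := by positivity
  obtain ⟨δ, hδ, hball⟩ := Metric.continuousAt_iff.1 hhc _ hε
  have hlt : s < min 1 (s + δ) := lt_min hs.2 (by linarith)
  filter_upwards [Ioo_mem_nhdsGT hlt] with t ⟨hst, ht⟩
  have ht1 : t < 1 := ht.trans_le (min_le_left _ _)
  have htδ : t < s + δ := ht.trans_le (min_le_right _ _)
  have hyt := hypos t ⟨hst, ht1⟩
  have hsub : 0 < t - s := sub_pos.2 hst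
  have key := hy.rpow_le_of_sub_le hp hp'def hy0 hst ht1.le hyt hε.le
    (fun u hu => by
      have hd : dist u s < δ := by
        rw [Real.dist_eq, abs_of_pos (sub_pos.2 hu.1)]
        linarith [hu.2]
      have hhu := hball hd
      rw [Real.dist_eq] at hhu
      linarith [(abs_lt.1 hhu).1])
    (fun u hu => (hfpos u ⟨hu.1, hu.2.trans ht1⟩).le)
  rw [Real.dist_eq, sub_zero, abs_of_nonneg (by positivity), div_lt_iff₀ hsub]
  have hhalf : p' * (η / (2 * p')) = η / 2 := by field_simp
  rw [hhalf] at key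
  nlinarith
end
end
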